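/- Let k ≥ 0, N ≥ 2 and N/2 < p < ∞. Then γ_{p,k} > 0 and γ_{p,k} is attained: there exists a_0 ∈ Γ_k ∩ L^p(B_1) with ‖a_0 − μ_k‖_{L^p(B_1)} = γ_{p,k}. -/

import Mathlib

open MeasureTheory Set Filter

noncomputable section

/-- The measure of the (N-1)-dimensional unit sphere in `ℝ^N`. -/
def omegaN (N : ℕ) : ℝ :=
  N * (volume (Metric.ball (0 : EuclideanSpace ℝ (Fin N)) 1)).toReal

/-- `u` is a radial Neumann solution of `Δu + a u = 0` on the unit ball of `ℝ^N`,
with explicit derivative function `u'` : `u` is continuous on `[0,1]`, differentiable on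
`(0,1]`, satisfies the integrated radial equation
`r^(N-1) u'(r) = -∫_0^r s^(N-1) a(s) u(s) ds` on `(0,1]`, and `u'(1) = 0`. -/
def IsRadialNeumannSolutionDeriv (N : ℕ) (a u u' : ℝ → ℝ) : Prop :=
  ContinuousOn u (Icc 0 1) ∧
  (∀ r ∈ Ioc (0:ℝ) 1, HasDerivAt u (u' r) r) ∧
  (∀ r ∈ Ioc (0:ℝ) 1,
    r ^ (N - 1) * u' r = - ∫ s in (0:ℝ)..r, s ^ (N - 1) * a s * u s) ∧
  u' 1 = 0

/-- `u` is a radial Neumann solution of `Δu + a u = 0` on the unit ball of `ℝ^N`. -/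
def IsRadialNeumannSolution (N : ℕ) (a u : ℝ → ℝ) : Prop :=
  ∃ u' : ℝ → ℝ, IsRadialNeumannSolutionDeriv N a u u'

/-- `u` is not identically zero on `[0,1]`. -/
def NontrivialSol (u : ℝ → ℝ) : Prop := ∃ r ∈ Icc (0:ℝ) 1, u r ≠ 0

/-- `μ ≺ a` : `a(r) ≥ μ` for a.e. `r ∈ (0,1)` and `a(r) > μ` on a set of positive measure. -/
def Prec (μ : ℝ) (a : ℝ → ℝ) : Prop :=
  (∀ᵐ r ∂(volume.restrict (Ioo (0:ℝ) 1)), μ ≤ a r) ∧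
  0 < volume {r ∈ Ioo (0:ℝ) 1 | μ < a r}

/-- A radial function `a` belongs to `L^p(B_1)` (finite `p`). -/
def RadialMemLp (N : ℕ) (p : ℝ) (a : ℝ → ℝ) : Prop :=
  IntegrableOn (fun r => r ^ (N - 1) * |a r| ^ p) (Ioo (0:ℝ) 1)

/-- A radial function `a` belongs to `L^∞(B_1)`. -/
def RadialMemLinfty (a : ℝ → ℝ) : Prop :=
  ∃ C : ℝ, ∀ᵐ r ∂(volume.restrict (Ioo (0:ℝ) 1)), |a r| ≤ C

/-- The `L^p(B_1)` norm of a radial function (finite `p`):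
`(ω_N ∫_0^1 r^(N-1) |a(r)|^p dr)^(1/p)`. -/
def radialLpNorm (N : ℕ) (p : ℝ) (a : ℝ → ℝ) : ℝ :=
  (omegaN N * ∫ r in (0:ℝ)..1, r ^ (N - 1) * |a r| ^ p) ^ (1 / p)

/-- The `L^∞(B_1)` norm of a radial function: essential supremum of `|a|` on `(0,1)`. -/
def radialLinftyNorm (a : ℝ → ℝ) : ℝ :=
  essSup (fun r => |a r|) (volume.restrict (Ioo (0:ℝ) 1))

/-- The admissible class `Γ_k` at level `μk`: radial measurable `a` with `μk ≺ a`, such that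
`Δu + a u = 0` has a nontrivial radial Neumann solution, and `a ∈ L^{N/2}(B_1)` if `N ≥ 3`,
or `a ∈ L^q(B_1)` for some `q ∈ (1,∞]` if `N = 2`. -/
def GammaSet (N : ℕ) (μk : ℝ) (a : ℝ → ℝ) : Prop :=
  Measurable a ∧ Prec μk a ∧
  (∃ u : ℝ → ℝ, IsRadialNeumannSolution N a u ∧ NontrivialSol u) ∧
  (if 3 ≤ N then RadialMemLp N ((N : ℝ) / 2) a
   else (∃ q : ℝ, 1 < q ∧ RadialMemLp N q a) ∨ RadialMemLinfty a)

/-- The Lyapunov constant `γ_{p,k}` for finite `p`. -/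
def gammaLyap (N : ℕ) (μk : ℝ) (p : ℝ) : ℝ :=
  sInf {t : ℝ | ∃ a : ℝ → ℝ, GammaSet N μk a ∧ RadialMemLp N p a ∧
    t = radialLpNorm N p (fun r => a r - μk)}

/-- The Lyapunov constant `γ_{∞,k}`. -/
def gammaLyapInfty (N : ℕ) (μk : ℝ) : ℝ :=
  sInf {t : ℝ | ∃ a : ℝ → ℝ, GammaSet N μk a ∧ RadialMemLinfty a ∧
    t = radialLinftyNorm (fun r => a r - μk)}

/-- `(μ, φ)` is the `k`-th radial Neumann eigenpair of `-Δ` on `B_1 ⊆ ℝ^N`: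
`μ ≥ 0`, `φ` is a nontrivial radial Neumann solution of `Δφ + μ φ = 0` having exactly `k`
zeros in `(0,1)`, all simple, given by `rz k < rz (k-1) < ⋯ < rz 1`. -/
def IsRadialNeumannEigenpair (N k : ℕ) (μ : ℝ) (φ : ℝ → ℝ) (rz : ℕ → ℝ) : Prop :=
  0 ≤ μ ∧
  IsRadialNeumannSolution N (fun _ => μ) φ ∧ NontrivialSol φ ∧
  (∀ i, 1 ≤ i → i ≤ k → rz i ∈ Ioo (0:ℝ) 1) ∧
  (∀ i j, 1 ≤ i → i < j → j ≤ k → rz j < rz i) ∧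
  (∀ x ∈ Ioo (0:ℝ) 1, (φ x = 0 ↔ ∃ i, 1 ≤ i ∧ i ≤ k ∧ x = rz i)) ∧
  (∀ i, 1 ≤ i → i ≤ k → ∃ d : ℝ, d ≠ 0 ∧ HasDerivAt φ d (rz i))

/-- `u` (with derivative `u'`) is a radial `H^1` solution of `Δu + a u = 0` in `B_1`:
continuous on `(0,1]`, differentiable on `(0,1)`, satisfying the integrated radial equation
between any two radii, with finite radial `H^1` energy. -/
def IsRadialH1Solution (N : ℕ) (a u u' : ℝ → ℝ) : Prop :=
  ContinuousOn u (Ioc 0 1) ∧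
  (∀ r ∈ Ioo (0:ℝ) 1, HasDerivAt u (u' r) r) ∧
  (∀ s ∈ Ioo (0:ℝ) 1, ∀ r ∈ Ioo (0:ℝ) 1, s < r →
    r ^ (N - 1) * u' r - s ^ (N - 1) * u' s
      = - ∫ t in s..r, t ^ (N - 1) * a t * u t) ∧
  IntegrableOn (fun r => r ^ (N - 1) * ((u' r) ^ 2 + (u r) ^ 2)) (Ioo (0:ℝ) 1)

/-- The Sobolev quotient: infimum of `(∫_{B_ρ} |∇w|²) / (∫_{B_ρ} |w|^q)^{2/q}` over nontrivial
`C^1` functions `w : ℝ^N → ℝ` with compact support contained in the ball `B_ρ`. -/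
def sobolevQuot (N : ℕ) (q : ℝ) (ρ : ℝ) : ℝ :=
  sInf {t : ℝ | ∃ w : EuclideanSpace ℝ (Fin N) → ℝ,
    ContDiff ℝ 1 w ∧ (∃ x, w x ≠ 0) ∧ tsupport w ⊆ Metric.ball 0 ρ ∧
    t = (∫ x in Metric.ball (0 : EuclideanSpace ℝ (Fin N)) ρ, ‖fderiv ℝ w x‖ ^ 2) /
        (∫ x in Metric.ball (0 : EuclideanSpace ℝ (Fin N)) ρ, |w x| ^ q) ^ (2 / q)}

theorem Ultrafilter.exists_tendsto_of_eventually_mem_Icc {ι : Type*} (U : Ultrafilter ι)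
    {f : ι → ℝ} {c d : ℝ} (h : ∀ᶠ i in U, f i ∈ Icc c d) :
    ∃ l ∈ Icc c d, Tendsto f U (nhds l) := by
  obtain ⟨l, hl, hle⟩ := (isCompact_Icc (a := c) (b := d)).ultrafilter_le_nhds (U.map f)
    (Filter.le_principal_iff.2 h)
  exact ⟨l, hl, hle⟩

section WeakCompactness

variable {X ι : Type*} [MeasurableSpace X] {ρ : Measure X}

theorem abs_integral_mul_le_rpow {p q : ℝ} (hpq : p.HolderConjugate q) {f g : X → ℝ} {C : ℝ}
    (hf : MemLp f (ENNReal.ofReal p) ρ) (hg : MemLp g (ENNReal.ofReal q) ρ)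
    (hC : ∫ x, |f x| ^ p ∂ρ ≤ C) :
    ∫ x, |f x| * |g x| ∂ρ ≤ C ^ (1 / p) * (∫ x, |g x| ^ q ∂ρ) ^ (1 / q) := by
  have h := integral_mul_norm_le_Lp_mul_Lq hpq hf hg
  simp only [Real.norm_eq_abs] at h
  refine h.trans ?_
  have h0 : 0 ≤ ∫ x, |f x| ^ p ∂ρ := by positivity
  have h1 : 0 ≤ ∫ x, |g x| ^ q ∂ρ := by positivity
  have hp := hpq.pos
  gcongr

theorem setIntegral_abs_le_rpow [IsFiniteMeasure ρ] {p q : ℝ} (hpq : p.HolderConjugate q)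
    {f : X → ℝ} {C : ℝ}
    (hf : MemLp f (ENNReal.ofReal p) ρ) (hC : ∫ x, |f x| ^ p ∂ρ ≤ C) {E : Set X}
    (hE : MeasurableSet E) :
    ∫ x in E, |f x| ∂ρ ≤ C ^ (1 / p) * (ρ.real E) ^ (1 / q) := by
  have hg : MemLp (E.indicator (fun _ => (1 : ℝ))) (ENNReal.ofReal q) ρ :=
    (memLp_const 1).indicator hE
  have h := abs_integral_mul_le_rpow hpq hf hg hC
  have e1 : ∫ x, |f x| * |E.indicator (fun _ => (1 : ℝ)) x| ∂ρ = ∫ x in E, |f x| ∂ρ := by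
    rw [← integral_indicator hE]
    congr 1; ext x
    by_cases hx : x ∈ E <;> simp [hx]
  have e2 : ∫ x, |E.indicator (fun _ => (1 : ℝ)) x| ^ q ∂ρ = ρ.real E := by
    rw [← integral_indicator_one hE]
    congr 1; ext x
    by_cases hx : x ∈ E <;> simp [hx, hpq.symm.pos.ne']
  rwa [e1, e2] at h

/-- Along an ultrafilter, an `L^p`-bounded family of nonnegative functions has a limiting density
in the sense of integrals over measurable sets. -/
theorem exists_density_of_bounded [IsFiniteMeasure ρ] {p q : ℝ} (hpq : p.HolderConjugate q)
    (U : Ultrafilter ι) {b : ι → X → ℝ} (hb0 : ∀ i x, 0 ≤ b i x) (hb : ∀ i, MemLp (b i) (ENNReal.ofReal p) ρ)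
    {K : ℝ} (hK : ∀ᶠ i in U, ∫ x, |b i x| ^ p ∂ρ ≤ K) :
    ∃ B : X → ℝ, Measurable B ∧ (∀ x, 0 ≤ B x) ∧ Integrable B ρ ∧
      ∀ E, MeasurableSet E → Tendsto (fun i => ∫ x in E, b i x ∂ρ) U (nhds (∫ x in E, B x ∂ρ)) := by
  classical
  have hp1 : 1 ≤ ENNReal.ofReal p := by
    rw [← ENNReal.ofReal_one]; exact ENNReal.ofReal_le_ofReal hpq.lt.le
  have hbint : ∀ i, Integrable (b i) ρ := fun i => (hb i).integrable hp1
  have hex : ∀ E, MeasurableSet E → ∃ l ∈ Icc 0 (K ^ (1 / p) * (ρ.real E) ^ (1 / q)),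
      Tendsto (fun i => ∫ x in E, b i x ∂ρ) U (nhds l) := by
    intro E hE
    apply U.exists_tendsto_of_eventually_mem_Icc
    filter_upwards [hK] with i hi
    refine ⟨integral_nonneg (hb0 i), ?_⟩
    have := setIntegral_abs_le_rpow hpq (hb i) hi hE
    simpa only [abs_of_nonneg (hb0 i _)] using this
  choose! m hm hlim using hex
  have hadd : ∀ E F, MeasurableSet E → MeasurableSet F → Disjoint E F →
      m (E ∪ F) = m E + m F := by
    intro E F hE hF hEF
    refine tendsto_nhds_unique (hlim _ (hE.union hF)) ?_
    refine ((hlim E hE).add (hlim F hF)).congr fun i => ?_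
    rw [setIntegral_union hEF hF (hbint i).integrableOn (hbint i).integrableOn]
  have hempty : m ∅ = 0 := by
    refine tendsto_nhds_unique (hlim ∅ .empty) ?_
    simp
  let ν : SignedMeasure X :=
    { measureOf' := fun E => if MeasurableSet E then m E else 0
      empty' := by simp [hempty]
      not_measurable' := fun E hE => if_neg hE
      m_iUnion' := by
        intro f hf hd
        have hU : MeasurableSet (⋃ i, f i) := MeasurableSet.iUnion hf
        simp only [hf, hU, if_true]
        rw [hasSum_iff_tendsto_nat_of_nonneg (fun i => (hm _ (hf i)).1)]
        have hpart : ∀ n, MeasurableSet (⋃ i ∈ Finset.range n, f i) := fun n =>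
          Finset.measurableSet_biUnion _ fun i _ => hf i
        have hdpart : ∀ n, Disjoint (⋃ i ∈ Finset.range n, f i) (f n) := by
          intro n
          simp only [disjoint_iUnion_left]
          intro i hi
          exact hd (Finset.mem_range.1 hi).ne
        have hsumm : ∀ n, m (⋃ i ∈ Finset.range n, f i) = ∑ i ∈ Finset.range n, m (f i) := by
          intro n
          induction n with
          | zero => simp [hempty]
          | succ n ih =>
            rw [Finset.sum_range_succ, ← ih, ← hadd _ _ (hpart n) (hf n) (hdpart n),
              Finset.range_add_one, Finset.set_biUnion_insert, union_comm]
        have hsub : ∀ n, (⋃ i ∈ Finset.range n, f i) ⊆ ⋃ i, f i := fun n =>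
          iUnion₂_subset fun i _ => subset_iUnion f i
        have hρ : Tendsto (fun n => ρ.real ((⋃ i, f i) \ ⋃ i ∈ Finset.range n, f i)) atTop
            (nhds 0) := by
          have hs := (ρ.toSignedMeasure.m_iUnion' hf hd).tendsto_sum_nat
          have hs' : Tendsto (fun n => ∑ i ∈ Finset.range n, ρ.real (f i)) atTop
              (nhds (ρ.real (⋃ i, f i))) := by
            have e : ∀ E, MeasurableSet E → ρ.toSignedMeasure.measureOf' E = ρ.real E :=
              fun E hE => Measure.toSignedMeasure_apply_measurable hE
            simpa only [e _ (hf _), e _ hU] using hs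
          have := hs'.const_sub (ρ.real (⋃ i, f i))
          rw [sub_self] at this
          refine this.congr fun n => ?_
          rw [measureReal_sdiff (hsub n) (hpart n), measureReal_biUnion_finset
            (fun i _ j _ hij => hd hij) (fun i _ => hf i)]
        have hq : 0 < 1 / q := by have := hpq.symm.pos; positivity
        have h0 : Tendsto (fun n => K ^ (1 / p) *
            (ρ.real ((⋃ i, f i) \ ⋃ i ∈ Finset.range n, f i)) ^ (1 / q)) atTop (nhds 0) := by
          have := (hρ.rpow_const (Or.inr hq.le)).const_mul (K ^ (1 / p))
          rwa [Real.zero_rpow hq.ne', mul_zero] at this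
        have h1 := squeeze_zero (fun n => (hm _ (hU.diff (hpart n))).1)
          (fun n => (hm _ (hU.diff (hpart n))).2) h0
        have h2 := h1.const_sub (m (⋃ i, f i))
        rw [sub_zero] at h2
        refine h2.congr fun n => ?_
        rw [← hsumm, sub_eq_iff_eq_add, ← hadd _ _ (hpart n) (hU.diff (hpart n))
          disjoint_sdiff_right, union_sdiff_cancel (hsub n)] }
  have hν : ∀ E, MeasurableSet E → ν E = m E := fun E hE => if_pos hE
  have hac : ν ≪ᵥ ρ.toENNRealVectorMeasure := by
    refine VectorMeasure.AbsolutelyContinuous.mk fun E hE h => ?_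
    rw [Measure.toENNRealVectorMeasure_apply_measurable hE] at h
    rw [hν E hE]
    refine le_antisymm ((hm E hE).2.trans ?_) (hm E hE).1
    have hq : 1 / q ≠ 0 := by have := hpq.symm.pos; positivity
    simp [measureReal_def, h, Real.zero_rpow hq, -one_div]
  have hdens := SignedMeasure.withDensityᵥ_rnDeriv_eq ν ρ hac
  have hrn : Integrable (ν.rnDeriv ρ) ρ := SignedMeasure.integrable_rnDeriv ν ρ
  have hset : ∀ E, MeasurableSet E → ∫ x in E, ν.rnDeriv ρ x ∂ρ = m E := by
    intro E hE
    rw [← hν E hE, ← withDensityᵥ_apply hrn hE, hdens]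
  have hnn : 0 ≤ᵐ[ρ] ν.rnDeriv ρ :=
    ae_nonneg_of_forall_setIntegral_nonneg hrn fun E hE _ => by
      rw [hset E hE]; exact (hm E hE).1
  have hae : (fun x => max (ν.rnDeriv ρ x) 0) =ᵐ[ρ] ν.rnDeriv ρ := by
    filter_upwards [hnn] with x hx using max_eq_left hx
  refine ⟨fun x => max (ν.rnDeriv ρ x) 0,
    (SignedMeasure.measurable_rnDeriv ν ρ).max measurable_const, fun x => le_max_right _ _,
    hrn.congr hae.symm, fun E hE => ?_⟩
  rw [integral_congr_ae (ae_restrict_of_ae hae), hset E hE]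
  exact hlim E hE

theorem tendsto_integral_simpleFunc_mul {U : Filter ι} {b : ι → X → ℝ} {B : X → ℝ}
    (hb : ∀ i, Integrable (b i) ρ) (hB : Integrable B ρ)
    (h : ∀ E, MeasurableSet E → Tendsto (fun i => ∫ x in E, b i x ∂ρ) U (nhds (∫ x in E, B x ∂ρ)))
    (s : SimpleFunc X ℝ) :
    Tendsto (fun i => ∫ x, s x * b i x ∂ρ) U (nhds (∫ x, s x * B x ∂ρ)) := by
  induction s using SimpleFunc.induction with
  | const c hE =>
    rename_i E
    have e : ∀ f : X → ℝ, ∫ x, (SimpleFunc.piecewise E hE (SimpleFunc.const X c)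
        (SimpleFunc.const X 0)) x * f x ∂ρ = c * ∫ x in E, f x ∂ρ := by
      intro f
      rw [← integral_const_mul, ← integral_indicator hE]
      congr 1; ext x
      by_cases hx : x ∈ E <;> simp [hx]
    simp only [e]
    exact (h E hE).const_mul c
  | add hfg hf hg =>
    rename_i f g
    have e : ∀ F : X → ℝ, Integrable F ρ → ∫ x, (f + g) x * F x ∂ρ
        = ∫ x, f x * F x ∂ρ + ∫ x, g x * F x ∂ρ := by
      intro F hF
      rw [← integral_add]
      · simp [add_mul]
      · obtain ⟨C, hC⟩ := f.exists_forall_norm_le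
        exact hF.bdd_mul f.aestronglyMeasurable (Eventually.of_forall hC)
      · obtain ⟨C, hC⟩ := g.exists_forall_norm_le
        exact hF.bdd_mul g.aestronglyMeasurable (Eventually.of_forall hC)
    simp only [e _ (hb _), e _ hB]
    exact hf.add hg

theorem memLp_of_tendsto_setIntegral [IsFiniteMeasure ρ] {p q : ℝ}
    (hpq : p.HolderConjugate q) {U : Filter ι} [U.NeBot]
    {b : ι → X → ℝ} {B : X → ℝ} (hb : ∀ i, MemLp (b i) (ENNReal.ofReal p) ρ)
    (hB : Integrable B ρ) (hBm : Measurable B) (hB0 : ∀ x, 0 ≤ B x)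
    (h : ∀ E, MeasurableSet E → Tendsto (fun i => ∫ x in E, b i x ∂ρ) U (nhds (∫ x in E, B x ∂ρ)))
    {c : ι → ℝ} {C : ℝ} (hc : ∀ i, ∫ x, |b i x| ^ p ∂ρ ≤ c i) (hC : Tendsto c U (nhds C)) :
    MemLp B (ENNReal.ofReal p) ρ ∧ ∫ x, |B x| ^ p ∂ρ ≤ C := by
  have hp := hpq.pos
  have hq := hpq.symm.pos
  have hp1 : 1 ≤ ENNReal.ofReal p := by
    rw [← ENNReal.ofReal_one]; exact ENNReal.ofReal_le_ofReal hpq.lt.le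
  have hbint : ∀ i, Integrable (b i) ρ := fun i => (hb i).integrable hp1
  have hc0 : ∀ i, 0 ≤ c i := fun i => (integral_nonneg fun x => by positivity).trans (hc i)
  have hC0 : 0 ≤ C := ge_of_tendsto' hC hc0
  have key : ∫⁻ x, ENNReal.ofReal (B x ^ p) ∂ρ ≤ ENNReal.ofReal C := by
    rw [lintegral_eq_nnreal]
    refine iSup₂_le fun φ hφ => ?_
    have hφB : ∀ x, (φ x : ℝ) ≤ B x ^ p := by
      intro x
      have := hφ x
      rw [← ENNReal.ofReal_coe_nnreal] at this
      exact (ENNReal.ofReal_le_ofReal_iff (Real.rpow_nonneg (hB0 x) p)).1 this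
    have hφint : Integrable (fun x => (φ x : ℝ)) ρ := by
      have := SimpleFunc.integrable_of_isFiniteMeasure (μ := ρ)
        (φ.map (fun y : NNReal => (y : ℝ)))
      exact this
    have hlin : (φ.map ((↑) : NNReal → ENNReal)).lintegral ρ
        = ENNReal.ofReal (∫ x, (φ x : ℝ) ∂ρ) := by
      rw [ofReal_integral_eq_lintegral_ofReal hφint (Eventually.of_forall fun x => (φ x).2),
        ← SimpleFunc.lintegral_eq_lintegral]
      congr 1; ext x; simp
    rw [hlin]
    apply ENNReal.ofReal_le_ofReal
    set T := ∫ x, (φ x : ℝ) ∂ρ with hT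
    have hT0 : 0 ≤ T := integral_nonneg fun x => (φ x).2
    set g : SimpleFunc X ℝ := φ.map (fun y : NNReal => (y : ℝ) ^ (1 / q)) with hg
    have hg0 : ∀ x, 0 ≤ g x := fun x => Real.rpow_nonneg (φ x).2 _
    have hgq : ∀ x, |g x| ^ q = φ x := by
      intro x
      rw [abs_of_nonneg (hg0 x)]
      change (((φ x : ℝ)) ^ (1 / q)) ^ q = _
      rw [← Real.rpow_mul (φ x).coe_nonneg, one_div_mul_cancel hq.ne', Real.rpow_one]
    have hgB : ∀ x, (φ x : ℝ) ≤ g x * B x := by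
      intro x
      have h1 : (φ x : ℝ) ^ (1 / p) ≤ B x := by
        calc (φ x : ℝ) ^ (1 / p) ≤ (B x ^ p) ^ (1 / p) :=
              Real.rpow_le_rpow (φ x).2 (hφB x) (by positivity)
          _ = B x := by rw [← Real.rpow_mul (hB0 x), mul_one_div_cancel hp.ne', Real.rpow_one]
      calc (φ x : ℝ) = (φ x : ℝ) ^ (1 / q + 1 / p) := by
            have : 1 / q + 1 / p = 1 := by
              have := hpq.symm.inv_add_inv_eq_one
              simpa using this
            rw [this, Real.rpow_one]
        _ = (φ x : ℝ) ^ (1 / q) * (φ x : ℝ) ^ (1 / p) :=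
            Real.rpow_add_of_nonneg (φ x).2 (by positivity) (by positivity)
        _ ≤ g x * B x := mul_le_mul_of_nonneg_left h1 (hg0 x)
    have hgLp : MemLp g (ENNReal.ofReal q) ρ := g.memLp_of_isFiniteMeasure _ _
    have hTle : T ≤ ∫ x, g x * B x ∂ρ := by
      refine integral_mono hφint ?_ hgB
      obtain ⟨M, hM⟩ := g.exists_forall_norm_le
      exact hB.bdd_mul g.aestronglyMeasurable (Eventually.of_forall hM)
    have hlim := tendsto_integral_simpleFunc_mul hbint hB h g
    have hbound : ∀ i, ∫ x, g x * b i x ∂ρ ≤ (c i) ^ (1 / p) * T ^ (1 / q) := by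
      intro i
      have h1 := abs_integral_mul_le_rpow hpq (hb i) hgLp (hc i)
      simp only [hgq] at h1
      refine (le_abs_self _).trans ((abs_integral_le_integral_abs).trans ?_)
      simpa only [abs_mul, mul_comm] using h1
    have hle : T ≤ C ^ (1 / p) * T ^ (1 / q) := by
      refine hTle.trans (le_of_tendsto_of_tendsto' hlim ?_ hbound)
      exact (hC.rpow_const (Or.inr (by positivity))).mul_const _
    rcases hT0.eq_or_lt with h0 | h0
    · rw [← h0]; exact hC0
    · have h2 : T ^ (1 / p) * T ^ (1 / q) ≤ C ^ (1 / p) * T ^ (1 / q) := by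
        rw [← Real.rpow_add h0, show 1 / p + 1 / q = 1 by simpa using hpq.inv_add_inv_eq_one,
          Real.rpow_one]
        exact hle
      have h3 := le_of_mul_le_mul_right h2 (Real.rpow_pos_of_pos h0 _)
      exact (Real.rpow_le_rpow_iff hT0 hC0 (by positivity)).1 h3
  have hBp : Integrable (fun x => |B x| ^ p) ρ := by
    refine ⟨(hBm.abs.pow_const p).aestronglyMeasurable, ?_⟩
    rw [hasFiniteIntegral_iff_ofReal (Eventually.of_forall fun x => by positivity)]
    simp only [abs_of_nonneg (hB0 _)]
    exact key.trans_lt ENNReal.ofReal_lt_top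
  constructor
  · rw [← integrable_norm_rpow_iff hBm.aestronglyMeasurable (by simpa using hp) (by simp),
      ENNReal.toReal_ofReal hp.le]
    exact hBp
  · rw [← ENNReal.ofReal_le_ofReal_iff hC0, ofReal_integral_eq_lintegral_ofReal hBp
      (Eventually.of_forall fun x => by positivity)]
    simpa only [abs_of_nonneg (hB0 _)] using key

theorem tendsto_integral_mul_of_tendsto_setIntegral [IsFiniteMeasure ρ] {p q : ℝ}
    (hpq : p.HolderConjugate q) {U : Filter ι}
    {b : ι → X → ℝ} {B : X → ℝ} (hb : ∀ i, MemLp (b i) (ENNReal.ofReal p) ρ)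
    (hB : MemLp B (ENNReal.ofReal p) ρ)
    (h : ∀ E, MeasurableSet E → Tendsto (fun i => ∫ x in E, b i x ∂ρ) U (nhds (∫ x in E, B x ∂ρ)))
    {K : ℝ} (hK : ∀ᶠ i in U, ∫ x, |b i x| ^ p ∂ρ ≤ K)
    {g : X → ℝ} (hg : MemLp g (ENNReal.ofReal q) ρ) :
    Tendsto (fun i => ∫ x, g x * b i x ∂ρ) U (nhds (∫ x, g x * B x ∂ρ)) := by
  have hp := hpq.pos
  have hq := hpq.symm.pos
  have hp1 : 1 ≤ ENNReal.ofReal p := by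
    rw [← ENNReal.ofReal_one]; exact ENNReal.ofReal_le_ofReal hpq.lt.le
  have hbint : ∀ i, Integrable (b i) ρ := fun i => (hb i).integrable hp1
  obtain ⟨L, hKL, hBL⟩ : ∃ L : ℝ, K ≤ L ∧ ∫ x, |B x| ^ p ∂ρ ≤ L :=
    ⟨max K _, le_max_left _ _, le_max_right _ _⟩
  set M := L ^ (1 / p) with hM
  have hM0 : 0 ≤ M :=
    Real.rpow_nonneg ((integral_nonneg fun x => by positivity).trans hBL) _
  rw [Metric.tendsto_nhds]
  intro ε hε
  set η := ε / (4 * (M + 1)) with hη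
  have hηpos : 0 < η := by positivity
  obtain ⟨s, hs, hsLp⟩ := hg.exists_simpleFunc_eLpNorm_sub_lt (by simp)
    (ε := ENNReal.ofReal η) (by simpa using hηpos)
  have hd : MemLp (fun x => g x - s x) (ENNReal.ofReal q) ρ := hg.sub hsLp
  have hdη : (∫ x, |g x - s x| ^ q ∂ρ) ^ (1 / q) ≤ η := by
    have e := hd.eLpNorm_eq_integral_rpow_norm (by simpa using hq) (by simp)
    rw [ENNReal.toReal_ofReal hq.le] at e
    have hs' : eLpNorm (fun x => g x - s x) (ENNReal.ofReal q) ρ < ENNReal.ofReal η := hs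
    rw [e, ENNReal.ofReal_lt_ofReal_iff hηpos] at hs'
    simpa using hs'.le
  have hdiff : ∀ F : X → ℝ, MemLp F (ENNReal.ofReal p) ρ → ∫ x, |F x| ^ p ∂ρ ≤ L →
      |∫ x, g x * F x ∂ρ - ∫ x, s x * F x ∂ρ| ≤ M * η := by
    intro F hF hFL
    have := hpq.ennrealOfReal.symm
    have hFi : Integrable F ρ := hF.integrable hp1
    have i1 : Integrable (fun x => g x * F x) ρ := hg.integrable_mul hF
    have i2 : Integrable (fun x => s x * F x) ρ := hsLp.integrable_mul hF
    rw [← integral_sub i1 i2]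
    refine (abs_integral_le_integral_abs).trans ?_
    have h1 := abs_integral_mul_le_rpow hpq hF hd hFL
    refine le_trans (le_of_eq ?_) (h1.trans (mul_le_mul_of_nonneg_left hdη hM0))
    congr 1; ext x
    rw [← sub_mul, abs_mul, mul_comm]
  have hMη : M * η ≤ ε / 4 := by
    rw [hη, mul_div_assoc', div_le_div_iff₀ (by positivity) (by positivity)]
    nlinarith
  have hs2 := tendsto_integral_simpleFunc_mul hbint (hB.integrable hp1) h s
  rw [Metric.tendsto_nhds] at hs2
  filter_upwards [hK, hs2 (ε / 4) (by positivity)] with i hi hi2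
  have h1 := hdiff (b i) (hb i) (hi.trans hKL)
  have h2 := hdiff B hB hBL
  rw [Real.dist_eq, abs_lt] at *
  rw [abs_le] at h1 h2
  constructor <;> linarith

end WeakCompactness

/-- The measure `r ^ (N - 1) dr` on `(0, 1]`. -/
def radialMeasure (N : ℕ) : Measure ℝ :=
  (volume.restrict (Ioc 0 1)).withDensity fun r => ENNReal.ofReal (r ^ (N - 1))

theorem measurable_radialDensity (N : ℕ) :
    Measurable fun r : ℝ => ENNReal.ofReal (r ^ (N - 1)) :=
  (measurable_id.pow_const _).ennreal_ofReal

theorem ae_radialMeasure_iff {N : ℕ} {P : ℝ → Prop} :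
    (∀ᵐ r ∂radialMeasure N, P r) ↔ ∀ᵐ r ∂volume.restrict (Ioc (0 : ℝ) 1), P r := by
  rw [radialMeasure, ae_withDensity_iff (measurable_radialDensity N)]
  refine eventually_congr ?_
  filter_upwards [ae_restrict_mem measurableSet_Ioc] with r hr
  have : ENNReal.ofReal (r ^ (N - 1)) ≠ 0 := by
    simpa using pow_pos hr.1 _
  simp [this]

theorem integrable_radialMeasure_iff {N : ℕ} {f : ℝ → ℝ} :
    Integrable f (radialMeasure N) ↔ IntegrableOn (fun r => r ^ (N - 1) * f r) (Ioc 0 1) := by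
  rw [radialMeasure, integrable_withDensity_iff_integrable_smul' (measurable_radialDensity N)
    (Eventually.of_forall fun _ => ENNReal.ofReal_lt_top)]
  refine integrable_congr ?_
  filter_upwards [ae_restrict_mem measurableSet_Ioc] with r hr
  rw [ENNReal.toReal_ofReal (pow_nonneg hr.1.le _), smul_eq_mul]

theorem setIntegral_radialMeasure {N : ℕ} {f : ℝ → ℝ} {s r : ℝ} (hs : 0 ≤ s) (hsr : s ≤ r)
    (hr : r ≤ 1) :
    ∫ x in Ioc s r, f x ∂radialMeasure N = ∫ x in s..r, x ^ (N - 1) * f x := by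
  rw [radialMeasure, setIntegral_withDensity_eq_setIntegral_toReal_smul
    (measurable_radialDensity N)
    (Eventually.of_forall fun _ => ENNReal.ofReal_lt_top) f measurableSet_Ioc,
    Measure.restrict_restrict measurableSet_Ioc,
    inter_eq_left.2 (Ioc_subset_Ioc hs hr), intervalIntegral.integral_of_le hsr]
  refine setIntegral_congr_fun measurableSet_Ioc fun x hx => ?_
  simp only [smul_eq_mul]
  rw [ENNReal.toReal_ofReal (pow_nonneg (hs.trans hx.1.le) _)]

theorem ae_mem_Ioc_radialMeasure (N : ℕ) : ∀ᵐ r ∂radialMeasure N, r ∈ Ioc (0 : ℝ) 1 :=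
  ae_radialMeasure_iff.2 (ae_restrict_mem measurableSet_Ioc)

theorem integral_radialMeasure {N : ℕ} {f : ℝ → ℝ} :
    ∫ x, f x ∂radialMeasure N = ∫ x in (0 : ℝ)..1, x ^ (N - 1) * f x := by
  rw [← setIntegral_radialMeasure le_rfl zero_le_one le_rfl]
  exact (setIntegral_eq_integral_of_ae_compl_eq_zero
    ((ae_mem_Ioc_radialMeasure N).mono fun x hx h => absurd hx h)).symm

instance (N : ℕ) : IsFiniteMeasure (radialMeasure N) := by
  have : Integrable (fun _ => (1 : ℝ)) (radialMeasure N) := by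
    rw [integrable_radialMeasure_iff]
    exact (Continuous.integrableOn_Icc (by fun_prop)).mono_set Ioc_subset_Icc_self
  exact (integrable_const_iff.1 this).resolve_left one_ne_zero

theorem radialMeasure_real_Ioc {N : ℕ} {s r : ℝ} (hs : 0 ≤ s) (hsr : s ≤ r) (hr : r ≤ 1) :
    (radialMeasure N).real (Ioc s r) = ∫ x in s..r, x ^ (N - 1) := by
  have := setIntegral_radialMeasure (N := N) (f := fun _ => 1) hs hsr hr
  simpa using this

theorem radialMeasure_real_Ioc_le {N : ℕ} {s r : ℝ} (hs : 0 ≤ s) (hsr : s ≤ r) (hr : r ≤ 1) :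
    (radialMeasure N).real (Ioc s r) ≤ r - s := by
  rw [radialMeasure_real_Ioc hs hsr hr]
  have : ∫ x in s..r, x ^ (N - 1) ≤ ∫ x in s..r, (1 : ℝ) := by
    apply intervalIntegral.integral_mono_on hsr
    · exact (continuous_pow _).intervalIntegrable _ _
    · simp
    · intro x hx
      exact pow_le_one₀ (hs.trans hx.1) (hx.2.trans hr)
  simpa using this

theorem radialMeasure_real_Ioc_zero_le {N : ℕ} (hN : 1 ≤ N) {r : ℝ} (h0 : 0 ≤ r) (hr : r ≤ 1) :
    (radialMeasure N).real (Ioc 0 r) ≤ r ^ N := by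
  rw [radialMeasure_real_Ioc le_rfl h0 hr, integral_pow]
  obtain ⟨n, rfl⟩ : ∃ n, N = n + 1 := ⟨N - 1, by omega⟩
  simp only [add_tsub_cancel_right]
  rw [zero_pow (by omega), sub_zero]
  apply div_le_self (by positivity)
  have : (0 : ℝ) ≤ n := by positivity
  linarith

/-- A bounded continuous factor preserves integrability. -/
theorem integrable_mul_of_continuousOn_Icc {N : ℕ} {a u : ℝ → ℝ}
    (ha : Integrable a (radialMeasure N)) (hu : ContinuousOn u (Icc 0 1)) :
    Integrable (fun x => a x * u x) (radialMeasure N) := by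
  obtain ⟨M, hM⟩ := isCompact_Icc.exists_bound_of_continuousOn hu
  have hm : AEStronglyMeasurable u (radialMeasure N) := by
    have : AEStronglyMeasurable u (volume.restrict (Ioc 0 1)) :=
      (hu.mono Ioc_subset_Icc_self).aestronglyMeasurable measurableSet_Ioc
    exact this.mono_ac (withDensity_absolutelyContinuous _ _)
  have := ha.bdd_mul (c := M) hm
    ((ae_mem_Ioc_radialMeasure N).mono fun x hx => hM x (Ioc_subset_Icc_self hx))
  simpa only [mul_comm] using this

/-- The flux `r ^ (N - 1) u'(r)` prescribed by the equation. -/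
def radialFlux (N : ℕ) (a u : ℝ → ℝ) (r : ℝ) : ℝ :=
  -∫ x in Ioc 0 r, a x * u x ∂radialMeasure N

theorem radialFlux_zero (N : ℕ) (a u : ℝ → ℝ) : radialFlux N a u 0 = 0 := by
  simp [radialFlux]

theorem radialFlux_eq {N : ℕ} {a u : ℝ → ℝ} {r : ℝ} (h0 : 0 ≤ r) (h1 : r ≤ 1) :
    radialFlux N a u r = -∫ s in (0 : ℝ)..r, s ^ (N - 1) * a s * u s := by
  simp only [radialFlux, setIntegral_radialMeasure le_rfl h0 h1, mul_assoc]

theorem radialFlux_sub {N : ℕ} {a u : ℝ → ℝ}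
    (h : Integrable (fun x => a x * u x) (radialMeasure N)) {s r : ℝ} (hs : 0 ≤ s) (hsr : s ≤ r) :
    radialFlux N a u r - radialFlux N a u s = -∫ x in Ioc s r, a x * u x ∂radialMeasure N := by
  have : Ioc 0 r = Ioc 0 s ∪ Ioc s r := (Ioc_union_Ioc_eq_Ioc hs hsr).symm
  simp only [radialFlux]
  rw [this, setIntegral_union (Ioc_disjoint_Ioc_of_le le_rfl) measurableSet_Ioc
    h.integrableOn h.integrableOn]
  ring

theorem continuousOn_radialFlux {N : ℕ} {a u : ℝ → ℝ}
    (h : Integrable (fun x => a x * u x) (radialMeasure N)) :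
    ContinuousOn (radialFlux N a u) (Icc 0 1) := by
  have hi : IntegrableOn (fun r => r ^ (N - 1) * (a r * u r)) (uIcc 0 1) := by
    rw [uIcc_of_le zero_le_one, integrableOn_Icc_iff_integrableOn_Ioc]
    exact integrable_radialMeasure_iff.1 h
  have := (intervalIntegral.continuousOn_primitive_interval hi).neg
  rw [uIcc_of_le zero_le_one] at this
  refine this.congr fun r hr => ?_
  simp only [radialFlux, setIntegral_radialMeasure le_rfl hr.1 hr.2, Pi.neg_apply]

theorem isRadialNeumannSolutionDeriv_iff {N : ℕ} {a u u' : ℝ → ℝ} :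
    IsRadialNeumannSolutionDeriv N a u u' ↔ ContinuousOn u (Icc 0 1) ∧
      (∀ r ∈ Ioc (0 : ℝ) 1, HasDerivAt u (u' r) r) ∧
      (∀ r ∈ Ioc (0 : ℝ) 1, r ^ (N - 1) * u' r = radialFlux N a u r) ∧ u' 1 = 0 := by
  refine and_congr_right fun _ => and_congr_right fun _ => and_congr_left fun _ => ?_
  refine forall₂_congr fun r hr => ?_
  rw [radialFlux_eq hr.1.le hr.2]

theorem radialFlux_congr_ae {N : ℕ} {a b u : ℝ → ℝ} (h : a =ᵐ[radialMeasure N] b) :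
    radialFlux N a u = radialFlux N b u := by
  funext r
  simp only [radialFlux]
  congr 1
  refine integral_congr_ae (ae_restrict_of_ae ?_)
  filter_upwards [h] with x hx
  rw [hx]

theorem IsRadialNeumannSolutionDeriv.congr_ae {N : ℕ} {a b u u' : ℝ → ℝ}
    (hu : IsRadialNeumannSolutionDeriv N a u u') (h : a =ᵐ[radialMeasure N] b) :
    IsRadialNeumannSolutionDeriv N b u u' := by
  rw [isRadialNeumannSolutionDeriv_iff] at *
  rwa [radialFlux_congr_ae h] at hu

namespace IsRadialNeumannSolutionDeriv

variable {N : ℕ} {a u u' : ℝ → ℝ}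

theorem flux_one (hu : IsRadialNeumannSolutionDeriv N a u u') : radialFlux N a u 1 = 0 := by
  obtain ⟨-, -, h, h1⟩ := isRadialNeumannSolutionDeriv_iff.1 hu
  rw [← h 1 (by simp), h1, mul_zero]

theorem deriv_eq (hu : IsRadialNeumannSolutionDeriv N a u u') {r : ℝ} (hr : r ∈ Ioc (0 : ℝ) 1) :
    u' r = radialFlux N a u r / r ^ (N - 1) := by
  obtain ⟨-, -, h, -⟩ := isRadialNeumannSolutionDeriv_iff.1 hu
  rw [← h r hr, mul_div_cancel_left₀ _ (pow_pos hr.1 _).ne']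

theorem continuousOn_deriv (hu : IsRadialNeumannSolutionDeriv N a u u')
    (ha : Integrable a (radialMeasure N)) : ContinuousOn u' (Ioc 0 1) := by
  have h := (continuousOn_radialFlux (integrable_mul_of_continuousOn_Icc ha hu.1)).mono
    (Ioc_subset_Icc_self (a := (0 : ℝ)) (b := 1))
  refine (h.div (by fun_prop) fun r hr => ?_).congr fun r hr => hu.deriv_eq hr
  exact (pow_pos hr.1 _).ne'

theorem sub_eq_integral (hu : IsRadialNeumannSolutionDeriv N a u u')
    (ha : Integrable a (radialMeasure N)) {s r : ℝ} (hs : 0 < s) (hsr : s ≤ r) (hr : r ≤ 1) :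
    u r - u s = ∫ x in s..r, u' x := by
  have hsub : uIcc s r ⊆ Ioc 0 1 := by
    rw [uIcc_of_le hsr]
    exact fun x hx => ⟨hs.trans_le hx.1, hx.2.trans hr⟩
  refine (intervalIntegral.integral_eq_sub_of_hasDerivAt (fun x hx => hu.2.1 x (hsub hx)) ?_).symm
  exact ((hu.continuousOn_deriv ha).mono hsub).intervalIntegrable

theorem smul (hu : IsRadialNeumannSolutionDeriv N a u u') (c : ℝ) :
    IsRadialNeumannSolutionDeriv N a (fun r => c * u r) (fun r => c * u' r) := by
  obtain ⟨h1, h2, h3, h4⟩ := isRadialNeumannSolutionDeriv_iff.1 hu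
  refine isRadialNeumannSolutionDeriv_iff.2 ⟨continuousOn_const.mul h1,
    fun r hr => (h2 r hr).const_mul c, fun r hr => ?_, by simp [h4]⟩
  rw [mul_left_comm, h3 r hr]
  simp only [radialFlux, mul_left_comm _ c, integral_const_mul, mul_neg]

/-- Every nontrivial solution can be normalized to have sup norm one. -/
theorem exists_normalized (hu : IsRadialNeumannSolutionDeriv N a u u') (h0 : NontrivialSol u) :
    ∃ v v' : ℝ → ℝ, IsRadialNeumannSolutionDeriv N a v v' ∧ (∀ r ∈ Icc (0 : ℝ) 1, |v r| ≤ 1) ∧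
      ∃ r ∈ Icc (0 : ℝ) 1, |v r| = 1 := by
  obtain ⟨x, hx, hmax⟩ := isCompact_Icc.exists_isMaxOn (nonempty_Icc.2 zero_le_one) hu.1.abs
  obtain ⟨y, hy, hy0⟩ := h0
  have hpos : 0 < |u x| := (abs_pos.2 hy0).trans_le (hmax hy)
  refine ⟨_, _, hu.smul |u x|⁻¹, fun r hr => ?_, x, hx, ?_⟩
  · rw [abs_mul, abs_inv, abs_abs, inv_mul_le_iff₀ hpos, mul_one]
    exact hmax hr
  · rw [abs_mul, abs_inv, abs_abs, inv_mul_cancel₀ hpos.ne']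

end IsRadialNeumannSolutionDeriv

theorem tendstoUniformlyOn_of_modulus {ι : Type*} {U : Filter ι} {f : ι → ℝ → ℝ} {g h : ℝ → ℝ}
    {D α : ℝ} (hα : 0 < α) (hh : ContinuousOn h (Icc 0 1))
    (hf : ∀ i, ∀ r ∈ Icc (0 : ℝ) 1, ∀ s ∈ Icc (0 : ℝ) 1, |f i r - f i s| ≤ D * |h r - h s| ^ α)
    (hlim : ∀ r ∈ Icc (0 : ℝ) 1, Tendsto (fun i => f i r) U (nhds (g r))) :
    TendstoUniformlyOn f g U (Icc 0 1) := by
  have hequi : EquicontinuousOn f (Icc 0 1) := by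
    intro x hx V hV
    obtain ⟨ε, hε, hV⟩ := Metric.mem_uniformity_dist.1 hV
    have hc : Tendsto (fun y => D * |h x - h y| ^ α) (nhdsWithin x (Icc 0 1)) (nhds 0) := by
      have h1 : Tendsto (fun y => |h x - h y|) (nhdsWithin x (Icc 0 1)) (nhds 0) := by
        have := ((hh x hx).tendsto.const_sub (h x)).abs
        simpa using this
      have h2 := (h1.rpow_const (Or.inr hα.le)).const_mul D
      rwa [Real.zero_rpow hα.ne', mul_zero] at h2
    filter_upwards [hc.eventually_lt_const hε, self_mem_nhdsWithin] with y hy hyI i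
    apply hV
    rw [Real.dist_eq]
    exact (hf i x hx y hyI).trans_lt hy
  have := (EquicontinuousOn.tendsto_uniformOnFun_iff_pi' (𝔖 := {Icc (0 : ℝ) 1}) (F := f)
    (by simpa using isCompact_Icc) (by simpa using hequi) U g).2
  rw [UniformOnFun.tendsto_iff_tendstoUniformlyOn] at this
  refine this ?_ _ rfl
  rw [tendsto_pi_nhds]
  rintro ⟨r, hr⟩
  exact hlim r (by simpa using hr)

theorem abs_setIntegral_mul_le {N : ℕ} {p q : ℝ} (hpq : p.HolderConjugate q) {a v : ℝ → ℝ}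
    (ha : MemLp a (ENNReal.ofReal p) (radialMeasure N)) {L M : ℝ}
    (hL : ∫ x, |a x| ^ p ∂radialMeasure N ≤ L) (hv : ∀ r ∈ Icc (0 : ℝ) 1, |v r| ≤ M)
    {s r : ℝ} (hs : 0 ≤ s) (hr : r ≤ 1) :
    |∫ x in Ioc s r, a x * v x ∂radialMeasure N|
      ≤ M * (L ^ (1 / p) * (radialMeasure N).real (Ioc s r) ^ (1 / q)) := by
  have hp1 : 1 ≤ ENNReal.ofReal p := by
    rw [← ENNReal.ofReal_one]; exact ENNReal.ofReal_le_ofReal hpq.lt.le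
  have hM : 0 ≤ M := (abs_nonneg _).trans (hv 0 (by simp))
  have hbint : Integrable a (radialMeasure N) := ha.integrable hp1
  calc |∫ x in Ioc s r, a x * v x ∂radialMeasure N|
      ≤ ∫ x in Ioc s r, M * |a x| ∂radialMeasure N := by
        rw [← Real.norm_eq_abs]
        refine norm_integral_le_of_norm_le (hbint.abs.const_mul M).integrableOn ?_
        filter_upwards [ae_restrict_mem measurableSet_Ioc] with x hx
        rw [Real.norm_eq_abs, abs_mul, mul_comm]
        exact mul_le_mul_of_nonneg_right (hv x ⟨hs.trans hx.1.le, hx.2.trans hr⟩) (abs_nonneg _)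
    _ = M * ∫ x in Ioc s r, |a x| ∂radialMeasure N := integral_const_mul _ _
    _ ≤ _ := mul_le_mul_of_nonneg_left (setIntegral_abs_le_rpow hpq ha hL measurableSet_Ioc) hM

section Holder

variable {N : ℕ} {p q L : ℝ} {a u u' : ℝ → ℝ}

theorem abs_radialFlux_sub_le (hpq : p.HolderConjugate q)
    (ha : MemLp a (ENNReal.ofReal p) (radialMeasure N))
    (hL : ∫ x, |a x| ^ p ∂radialMeasure N ≤ L) (hu : ContinuousOn u (Icc 0 1))
    (hb : ∀ r ∈ Icc (0 : ℝ) 1, |u r| ≤ 1) {s r : ℝ}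
    (hs : s ∈ Icc (0 : ℝ) 1) (hr : r ∈ Icc (0 : ℝ) 1) :
    |radialFlux N a u r - radialFlux N a u s| ≤ L ^ (1 / p) * |r - s| ^ (1 / q) := by
  have hp1 : 1 ≤ ENNReal.ofReal p := by
    rw [← ENNReal.ofReal_one]; exact ENNReal.ofReal_le_ofReal hpq.lt.le
  have hL0 : 0 ≤ L := (integral_nonneg fun x => by positivity).trans hL
  have hq := hpq.symm.pos
  wlog hsr : s ≤ r generalizing s r
  · rw [abs_sub_comm, abs_sub_comm r s]
    exact this hr hs (le_of_not_ge hsr)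
  rw [radialFlux_sub (integrable_mul_of_continuousOn_Icc (ha.integrable hp1) hu) hs.1 hsr, abs_neg]
  refine (abs_setIntegral_mul_le hpq ha hL hb hs.1 hr.2).trans ?_
  rw [one_mul, abs_of_nonneg (sub_nonneg.2 hsr)]
  gcongr
  exact radialMeasure_real_Ioc_le hs.1 hsr hr.2

namespace IsRadialNeumannSolutionDeriv

theorem abs_deriv_le (hN : 1 ≤ N) (hpq : p.HolderConjugate q)
    (ha : MemLp a (ENNReal.ofReal p) (radialMeasure N))
    (hL : ∫ x, |a x| ^ p ∂radialMeasure N ≤ L) (hu : IsRadialNeumannSolutionDeriv N a u u')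
    (hb : ∀ r ∈ Icc (0 : ℝ) 1, |u r| ≤ 1) {r : ℝ} (hr : r ∈ Ioc (0 : ℝ) 1) :
    |u' r| ≤ L ^ (1 / p) * r ^ (1 - N / p : ℝ) := by
  have hL0 : 0 ≤ L := (integral_nonneg fun x => by positivity).trans hL
  have hq := hpq.symm.pos
  have hpos : 0 < r ^ (N - 1) := pow_pos hr.1 _
  rw [hu.deriv_eq hr, abs_div, abs_of_pos hpos, div_le_iff₀ hpos, radialFlux, abs_neg]
  refine (abs_setIntegral_mul_le hpq ha hL hb le_rfl hr.2).trans ?_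
  rw [one_mul, mul_assoc]
  refine mul_le_mul_of_nonneg_left ?_ (by positivity)
  calc (radialMeasure N).real (Ioc 0 r) ^ (1 / q) ≤ (r ^ N) ^ (1 / q) := by
        gcongr
        exact radialMeasure_real_Ioc_zero_le hN hr.1.le hr.2
    _ = r ^ (1 - N / p : ℝ) * r ^ (N - 1) := by
        rw [← Real.rpow_natCast r N, ← Real.rpow_mul hr.1.le, ← Real.rpow_natCast r (N - 1),
          ← Real.rpow_add hr.1]
        congr 1
        have h1 : 1 / q = 1 - 1 / p := by
          have := hpq.inv_add_inv_eq_one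
          simp only [one_div]; linarith
        rw [h1, Nat.cast_sub hN]
        push_cast
        ring

theorem abs_sub_le (hN : 1 ≤ N) (hpq : p.HolderConjugate q) (hp : (N : ℝ) / 2 < p)
    (ha : MemLp a (ENNReal.ofReal p) (radialMeasure N))
    (hL : ∫ x, |a x| ^ p ∂radialMeasure N ≤ L) (hu : IsRadialNeumannSolutionDeriv N a u u')
    (hb : ∀ r ∈ Icc (0 : ℝ) 1, |u r| ≤ 1) {r s : ℝ}
    (hr : r ∈ Icc (0 : ℝ) 1) (hs : s ∈ Icc (0 : ℝ) 1) :
    |u r - u s| ≤ L ^ (1 / p) / (2 - N / p) * |r ^ (2 - N / p : ℝ) - s ^ (2 - N / p : ℝ)| := by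
  have hp0 := hpq.pos
  have hθ : (0 : ℝ) < 2 - N / p := by
    rw [sub_pos, div_lt_iff₀ hp0]; linarith
  set θ : ℝ := 2 - N / p with hθdef
  set D : ℝ := L ^ (1 / p) with hD
  have hpow : ∀ x ∈ Ioo (0 : ℝ) 1,
      HasDerivAt (fun x => D / θ * x ^ θ) (D * x ^ (1 - N / p : ℝ)) x := by
    intro x hx
    have := (Real.hasDerivAt_rpow_const (p := θ) (Or.inl hx.1.ne')).const_mul (D / θ)
    convert! this using 1
    rw [← mul_assoc, div_mul_cancel₀ _ hθ.ne', hθdef]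
    congr 2
    ring
  have hcont : ContinuousOn (fun x : ℝ => D / θ * x ^ θ) (Icc 0 1) :=
    continuousOn_const.mul (continuousOn_id.rpow_const fun _ _ => Or.inr hθ.le)
  have hder : ∀ x ∈ Ioo (0 : ℝ) 1, |u' x| ≤ D * x ^ (1 - N / p : ℝ) := fun x hx =>
    hu.abs_deriv_le hN hpq ha hL hb ⟨hx.1, hx.2.le⟩
  have hmono : ∀ σ : ℝ, |σ| = 1 → MonotoneOn (fun x => D / θ * x ^ θ + σ * u x) (Icc 0 1) := by
    intro σ hσ
    have hd : ∀ x ∈ Ioo (0 : ℝ) 1, HasDerivAt (fun x => D / θ * x ^ θ + σ * u x)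
        (D * x ^ (1 - N / p : ℝ) + σ * u' x) x := fun x hx =>
      (hpow x hx).add ((hu.2.1 x ⟨hx.1, hx.2.le⟩).const_mul σ)
    refine monotoneOn_of_deriv_nonneg (convex_Icc 0 1)
      (hcont.add (continuousOn_const.mul hu.1)) ?_ ?_
    · rw [interior_Icc]
      exact fun x hx => (hd x hx).differentiableAt.differentiableWithinAt
    · rw [interior_Icc]
      intro x hx
      rw [(hd x hx).deriv]
      have := hder x hx
      have h2 : |σ * u' x| = |u' x| := by rw [abs_mul, hσ, one_mul]
      have := neg_abs_le (σ * u' x)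
      linarith
  wlog hsr : s ≤ r generalizing s r
  · rw [abs_sub_comm, abs_sub_comm (r ^ θ)]
    exact this hs hr (le_of_not_ge hsr)
  have h1 := hmono 1 (by simp) hs hr hsr
  have h2 := hmono (-1) (by simp) hs hr hsr
  have h3 : D / θ * |r ^ θ - s ^ θ| = D / θ * r ^ θ - D / θ * s ^ θ := by
    rw [abs_of_nonneg (sub_nonneg.2 (Real.rpow_le_rpow hs.1 hsr hθ.le)), mul_sub]
  simp only at h1 h2
  rw [h3, abs_le]
  constructor <;> linarith

end IsRadialNeumannSolutionDeriv

end Holder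

theorem exists_limit_solution {ι : Type*} (U : Ultrafilter ι) {N : ℕ} (hN : 1 ≤ N) {p q L : ℝ}
    (hpq : p.HolderConjugate q) (hp : (N : ℝ) / 2 < p) {a u u' : ι → ℝ → ℝ} {A : ℝ → ℝ}
    (ha : ∀ i, MemLp (a i) (ENNReal.ofReal p) (radialMeasure N))
    (hL : ∀ i, ∫ x, |a i x| ^ p ∂radialMeasure N ≤ L)
    (hA : MemLp A (ENNReal.ofReal p) (radialMeasure N))
    (hweak : ∀ g, MemLp g (ENNReal.ofReal q) (radialMeasure N) →
      Tendsto (fun i => ∫ x, g x * a i x ∂radialMeasure N) U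
        (nhds (∫ x, g x * A x ∂radialMeasure N)))
    (hu : ∀ i, IsRadialNeumannSolutionDeriv N (a i) (u i) (u' i))
    (hb : ∀ i, ∀ r ∈ Icc (0 : ℝ) 1, |u i r| ≤ 1) :
    ∃ v v', IsRadialNeumannSolutionDeriv N A v v' ∧ TendstoUniformlyOn u v U (Icc 0 1) := by
  have hp1 : 1 ≤ ENNReal.ofReal p := by
    rw [← ENNReal.ofReal_one]; exact ENNReal.ofReal_le_ofReal hpq.lt.le
  have hp0 := hpq.pos
  have hq0 := hpq.symm.pos
  have hθ : (0 : ℝ) < 2 - N / p := by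
    rw [sub_pos, div_lt_iff₀ hp0]; linarith
  have haint : ∀ i, Integrable (a i) (radialMeasure N) := fun i => (ha i).integrable hp1
  have hAint : Integrable A (radialMeasure N) := hA.integrable hp1
  have hex : ∀ r ∈ Icc (0 : ℝ) 1, ∃ l ∈ Icc (-1 : ℝ) 1, Tendsto (fun i => u i r) U (nhds l) :=
    fun r hr => U.exists_tendsto_of_eventually_mem_Icc
      (Eventually.of_forall fun i => abs_le.1 (hb i r hr))
  choose! w hw1 hwlim using hex
  have hunif : TendstoUniformlyOn u w U (Icc 0 1) := by
    refine tendstoUniformlyOn_of_modulus (h := fun r => r ^ (2 - N / p : ℝ))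
      (D := L ^ (1 / p) / (2 - N / p)) one_pos
      (continuousOn_id.rpow_const fun _ _ => Or.inr hθ.le) (fun i r hr s hs => ?_) hwlim
    rw [Real.rpow_one]
    exact (hu i).abs_sub_le hN hpq hp (ha i) (hL i) (hb i) hr hs
  have hwc : ContinuousOn w (Icc 0 1) :=
    hunif.continuousOn (Eventually.of_forall fun i => (hu i).1).frequently
  have hwLp : MemLp w (ENNReal.ofReal q) (radialMeasure N) := by
    refine MemLp.of_bound ?_ 1 ((ae_mem_Ioc_radialMeasure N).mono fun r hr => ?_)
    · exact ((hwc.mono Ioc_subset_Icc_self).aestronglyMeasurable measurableSet_Ioc).mono_ac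
        (withDensity_absolutelyContinuous _ _)
    · exact abs_le.2 (hw1 r (Ioc_subset_Icc_self hr))
  have hflux : ∀ r ∈ Icc (0 : ℝ) 1,
      Tendsto (fun i => radialFlux N (a i) (u i) r) U (nhds (radialFlux N A w r)) := by
    intro r hr
    have hmain := hweak _ (hwLp.indicator (measurableSet_Ioc (a := (0 : ℝ)) (b := r)))
    have e : ∀ F : ℝ → ℝ, ∫ x, (Ioc 0 r).indicator w x * F x ∂radialMeasure N
        = ∫ x in Ioc 0 r, F x * w x ∂radialMeasure N := by
      intro F
      rw [← integral_indicator measurableSet_Ioc]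
      congr 1; ext x
      by_cases hx : x ∈ Ioc 0 r
      · simp [hx, mul_comm]
      · simp [hx]
    simp only [e] at hmain
    have herr : Tendsto (fun i => ∫ x in Ioc 0 r, a i x * (u i x - w x) ∂radialMeasure N) U
        (nhds 0) := by
      rw [Metric.tendsto_nhds]
      intro ε hε
      set R := L ^ (1 / p) * (radialMeasure N).real (Ioc 0 r) ^ (1 / q) with hR
      have hη : 0 < ε / (|R| + 1) := by positivity
      filter_upwards [Metric.tendstoUniformlyOn_iff.1 hunif _ hη] with i hi
      rw [Real.dist_eq, sub_zero]
      have h1 := abs_setIntegral_mul_le hpq (ha i) (hL i) (v := fun x => u i x - w x)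
        (M := ε / (|R| + 1)) (fun x hx => by
          have := hi x hx
          rw [dist_comm, Real.dist_eq] at this
          exact this.le) le_rfl hr.2
      refine h1.trans_lt ?_
      rw [← hR, div_mul_eq_mul_div, div_lt_iff₀ (by positivity)]
      nlinarith [le_abs_self R]
    have hsum := (hmain.add herr).neg
    rw [add_zero] at hsum
    refine hsum.congr fun i => ?_
    rw [radialFlux, ← integral_add]
    · congr 2; ext x; ring
    · exact (integrable_mul_of_continuousOn_Icc (haint i) hwc).integrableOn
    · exact (integrable_mul_of_continuousOn_Icc (haint i) ((hu i).1.sub hwc)).integrableOn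
  have hfluxunif : TendstoUniformlyOn (fun i => radialFlux N (a i) (u i)) (radialFlux N A w) U
      (Icc 0 1) :=
    tendstoUniformlyOn_of_modulus (h := id) (D := L ^ (1 / p)) (α := 1 / q) (by positivity)
      continuousOn_id
      (fun i r hr s hs => abs_radialFlux_sub_le hpq (ha i) (hL i) (hu i).1 (hb i) hs hr) hflux
  set P := radialFlux N A w with hP
  have hPc : ContinuousOn P (Icc 0 1) :=
    continuousOn_radialFlux (integrable_mul_of_continuousOn_Icc hAint hwc)
  have hP1 : P 1 = 0 := by
    refine tendsto_nhds_unique (hflux 1 (by simp)) ?_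
    simp only [(hu _).flux_one, tendsto_const_nhds]
  have hFTC : ∀ r ∈ Ioc (0 : ℝ) 1, w 1 - w r = ∫ x in r..1, P x / x ^ (N - 1) := by
    intro r hr
    have hsub : uIcc r 1 ⊆ Ioc 0 1 := by
      rw [uIcc_of_le hr.2]
      exact fun x hx => ⟨hr.1.trans_le hx.1, hx.2⟩
    have hii : ∀ {F : ℝ → ℝ}, ContinuousOn F (Icc 0 1) →
        IntervalIntegrable (fun x => F x / x ^ (N - 1)) volume r 1 := by
      intro F hF
      refine ContinuousOn.intervalIntegrable ?_
      exact (hF.mono (hsub.trans Ioc_subset_Icc_self)).div (by fun_prop)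
        fun x hx => (pow_pos (hsub hx).1 _).ne'
    refine tendsto_nhds_unique
      ((hwlim 1 (by simp)).sub (hwlim r (Ioc_subset_Icc_self hr))) ?_
    rw [Metric.tendsto_nhds]
    intro ε hε
    have hrN : 0 < r ^ (N - 1) := pow_pos hr.1 _
    filter_upwards [Metric.tendstoUniformlyOn_iff.1 hfluxunif (ε / 2 * r ^ (N - 1))
      (by positivity)] with i hi
    have h1 : u i 1 - u i r = ∫ x in r..1, radialFlux N (a i) (u i) x / x ^ (N - 1) := by
      rw [(hu i).sub_eq_integral (haint i) hr.1 hr.2 le_rfl]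
      exact intervalIntegral.integral_congr fun x hx => (hu i).deriv_eq (hsub hx)
    rw [h1, Real.dist_eq, ← intervalIntegral.integral_sub
      (hii (continuousOn_radialFlux (integrable_mul_of_continuousOn_Icc (haint i) (hu i).1)))
      (hii hPc), ← Real.norm_eq_abs]
    refine (intervalIntegral.norm_integral_le_of_norm_le_const (C := ε / 2) fun x hx => ?_).trans_lt
      ?_
    · have hx' := hsub (uIoc_subset_uIcc hx)
      have hrx : r ≤ x := by
        rw [uIoc_of_le hr.2] at hx; exact hx.1.le
      have h2 := hi x (Ioc_subset_Icc_self hx')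
      rw [dist_comm, Real.dist_eq] at h2
      have hxN : 0 < x ^ (N - 1) := pow_pos hx'.1 _
      rw [← sub_div, Real.norm_eq_abs, abs_div, abs_of_pos hxN, div_le_iff₀ hxN]
      refine h2.le.trans (mul_le_mul_of_nonneg_left ?_ (by positivity))
      exact pow_le_pow_left₀ hr.1.le hrx _
    · rw [abs_of_nonneg (sub_nonneg.2 hr.2)]
      nlinarith [hr.1]
  let Q : ℝ → ℝ := fun x => P (min x 1) / (min x 1) ^ (N - 1)
  have hQ : ∀ x ∈ Ioc (0 : ℝ) 1, Q x = P x / x ^ (N - 1) := fun x hx => by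
    simp only [Q, min_eq_left hx.2]
  have hQc : ContinuousOn Q (Ioi 0) := by
    have hm : MapsTo (fun x : ℝ => min x 1) (Ioi 0) (Ioc 0 1) := fun x hx =>
      ⟨lt_min hx one_pos, min_le_right _ _⟩
    refine ContinuousOn.div ?_ (by fun_prop) fun x hx => (pow_pos (hm hx).1 _).ne'
    exact hPc.comp (by fun_prop) (hm.mono_right Ioc_subset_Icc_self)
  let v : ℝ → ℝ := fun r => if r ≤ 0 then w 0 else w 1 + ∫ x in (1 : ℝ)..r, Q x
  have hvw : EqOn v w (Icc 0 1) := by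
    intro r hr
    rcases hr.1.eq_or_lt with h0 | h0
    · simp [v, ← h0]
    · have h1 : ∫ x in r..1, Q x = ∫ x in r..1, P x / x ^ (N - 1) := by
        refine intervalIntegral.integral_congr fun x hx => hQ x ?_
        rw [uIcc_of_le hr.2] at hx
        exact ⟨h0.trans_le hx.1, hx.2⟩
      simp only [v, not_le.2 h0, if_false]
      rw [intervalIntegral.integral_symm, h1, ← hFTC r ⟨h0, hr.2⟩]
      ring
  refine ⟨v, Q, isRadialNeumannSolutionDeriv_iff.2 ⟨hwc.congr hvw, ?_, ?_, ?_⟩,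
    hunif.congr_right fun r hr => (hvw hr).symm⟩
  · intro r hr
    have hev : v =ᶠ[nhds r] fun r => w 1 + ∫ x in (1 : ℝ)..r, Q x := by
      filter_upwards [Ioi_mem_nhds hr.1] with x hx
      simp only [v, not_le.2 (mem_Ioi.1 hx), if_false]
    refine HasDerivAt.congr_of_eventuallyEq ?_ hev
    refine (intervalIntegral.integral_hasDerivAt_right ?_ ?_ ?_).const_add _
    · refine (hQc.mono ?_).intervalIntegrable
      rw [uIcc_of_ge hr.2]
      exact fun x hx => hr.1.trans_le hx.1
    · exact hQc.stronglyMeasurableAtFilter isOpen_Ioi r hr.1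
    · exact hQc.continuousAt (Ioi_mem_nhds hr.1)
  · intro r hr
    rw [hQ r hr, mul_div_cancel₀ _ (pow_pos hr.1 _).ne']
    simp only [hP, radialFlux]
    congr 1
    refine setIntegral_congr_fun measurableSet_Ioc fun x hx => ?_
    rw [hvw ⟨hx.1.le, hx.2.trans hr.2⟩]
  · rw [hQ 1 (by simp), hP1, zero_div]

/-- A backward Gronwall inequality on a subinterval of `[0, 1]`. -/
theorem le_of_le_add_mul_integral {g : ℝ → ℝ} {α β A K : ℝ} (hα : 0 ≤ α) (hβ : β ≤ 1)
    (hA : 0 ≤ A) (hK : 0 ≤ K) (hg : ContinuousOn g (Icc α β))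
    (h : ∀ r ∈ Icc α β, g r ≤ A + K * ∫ x in r..β, g x) {r : ℝ} (hr : r ∈ Icc α β)
    (hgr : 0 ≤ g r) : g r ≤ 2 * A * Real.exp (2 * K + 1) := by
  set l : ℝ := 2 * K + 1 with hl
  have hl0 : 0 < l := by positivity
  have hle : α ≤ β := hr.1.trans hr.2
  obtain ⟨x₀, hx₀, hmax⟩ := isCompact_Icc.exists_isMaxOn (nonempty_Icc.2 hle)
    (hg.mul (f := g) (g := fun x => Real.exp (l * x)) (by fun_prop))
  set M : ℝ := g x₀ * Real.exp (l * x₀) with hM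
  have hMr : g r * Real.exp (l * r) ≤ M := hmax hr
  have hM0 : 0 ≤ M := (mul_nonneg hgr (Real.exp_pos _).le).trans hMr
  have hgM : ∀ x ∈ Icc α β, g x ≤ M * Real.exp (-l * x) := by
    intro x hx
    have : g x * Real.exp (l * x) ≤ M := hmax hx
    rw [neg_mul, Real.exp_neg, ← div_eq_mul_inv, le_div_iff₀ (Real.exp_pos _)]
    exact this
  have hsub : uIcc x₀ β ⊆ Icc α β := by
    rw [uIcc_of_le hx₀.2]; exact Icc_subset_Icc_left hx₀.1
  have hI : ∫ x in x₀..β, g x ≤ M * (Real.exp (-l * x₀) / l) := by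
    calc ∫ x in x₀..β, g x ≤ ∫ x in x₀..β, M * Real.exp (-l * x) := by
          refine intervalIntegral.integral_mono_on hx₀.2 (hg.mono hsub).intervalIntegrable
            (Continuous.intervalIntegrable (by fun_prop) _ _) fun x hx => hgM x ?_
          exact ⟨hx₀.1.trans hx.1, hx.2⟩
      _ = M * ((Real.exp (-l * x₀) - Real.exp (-l * β)) / l) := by
          rw [intervalIntegral.integral_const_mul,
            intervalIntegral.integral_comp_mul_left _ (neg_ne_zero.2 hl0.ne'), integral_exp,
            smul_eq_mul]
          field_simp
          ring
      _ ≤ _ := by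
          gcongr
          linarith [Real.exp_pos (-l * β)]
  have hexp : Real.exp (-l * x₀) * Real.exp (l * x₀) = 1 := by
    rw [← Real.exp_add]; simp
  have hM1 : M ≤ A * Real.exp l + M / 2 := by
    have h1 : g x₀ ≤ A + K * (M * (Real.exp (-l * x₀) / l)) :=
      (h x₀ hx₀).trans (by gcongr)
    have h2 : M ≤ (A + K * (M * (Real.exp (-l * x₀) / l))) * Real.exp (l * x₀) := by
      rw [hM]; gcongr
    have h3 : (A + K * (M * (Real.exp (-l * x₀) / l))) * Real.exp (l * x₀)
        = A * Real.exp (l * x₀) + M * (K / l) := by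
      have : K * (M * (Real.exp (-l * x₀) / l)) * Real.exp (l * x₀)
        = M * (K / l) * (Real.exp (-l * x₀) * Real.exp (l * x₀)) := by ring
      rw [add_mul, this, hexp, mul_one]
    have h4 : A * Real.exp (l * x₀) ≤ A * Real.exp l := by
      gcongr
      nlinarith [hx₀.2]
    have h5 : K / l ≤ 1 / 2 := by
      rw [div_le_iff₀ hl0, hl]; linarith
    nlinarith
  have h1 : 1 ≤ Real.exp (l * r) := Real.one_le_exp (mul_nonneg hl0.le (hα.trans hr.1))
  nlinarith

theorem setIntegral_radialMeasure_le {N : ℕ} {f : ℝ → ℝ} (hf : ContinuousOn f (Icc 0 1))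
    {s r : ℝ} (hs : 0 ≤ s) (hsr : s ≤ r) (hr : r ≤ 1) :
    ∫ x in Ioc s r, |f x| ∂radialMeasure N ≤ ∫ x in s..r, |f x| := by
  rw [setIntegral_radialMeasure hs hsr hr]
  have hsub : uIcc s r ⊆ Icc 0 1 := by
    rw [uIcc_of_le hsr]; exact Icc_subset_Icc hs hr
  have hc : ContinuousOn (fun x => |f x|) (uIcc s r) := (hf.mono hsub).abs
  refine intervalIntegral.integral_mono_on hsr
    (ContinuousOn.mul (by fun_prop) hc).intervalIntegrable hc.intervalIntegrable fun x hx => ?_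
  exact mul_le_of_le_one_left (abs_nonneg _) (pow_le_one₀ (hs.trans hx.1) (hx.2.trans hr))

section Perturbation

variable {N : ℕ} {μ : ℝ} {b u u' φ φ' : ℝ → ℝ}

namespace IsRadialNeumannSolutionDeriv

theorem abs_sub_mul_le (hb : Integrable b (radialMeasure N)) (hb0 : ∀ x, 0 ≤ b x)
    (hu : IsRadialNeumannSolutionDeriv N (fun x => μ + b x) u u')
    (hφ : IsRadialNeumannSolutionDeriv N (fun _ => μ) φ φ') {c r₀ δ : ℝ}
    (hδ : 0 < δ) (hr₀ : r₀ ≤ 1) (he : u r₀ = c * φ r₀) (he' : u' r₀ = c * φ' r₀)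
    {r : ℝ} (hr : r ∈ Icc δ r₀) :
    |u r - c * φ r| ≤ 2 * ((∫ x, b x * |u x| ∂radialMeasure N) / δ ^ (N - 1)) *
      Real.exp (2 * (|μ| / δ ^ (N - 1)) + 1) := by
  have hδr : δ ≤ r₀ := hr.1.trans hr.2
  have hδN : 0 < δ ^ (N - 1) := pow_pos hδ _
  set e : ℝ → ℝ := fun r => u r - c * φ r with hedef
  set B := ∫ x, b x * |u x| ∂radialMeasure N with hBdef
  have hB : 0 ≤ B := integral_nonneg fun x => mul_nonneg (hb0 x) (abs_nonneg _)
  have hec : ContinuousOn e (Icc 0 1) := hu.1.sub (continuousOn_const.mul hφ.1)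
  have hμb : Integrable (fun x => μ + b x) (radialMeasure N) := (integrable_const μ).add hb
  have hμ : Integrable (fun _ => μ) (radialMeasure N) := integrable_const μ
  have hiu := integrable_mul_of_continuousOn_Icc hμb hu.1
  have hiφ := integrable_mul_of_continuousOn_Icc hμ hφ.1
  have hibu := integrable_mul_of_continuousOn_Icc hb hu.1.abs
  have hie := integrable_mul_of_continuousOn_Icc hμ hec
  have hsubI : Icc δ r₀ ⊆ Ioc 0 1 := fun x hx => ⟨hδ.trans_le hx.1, hx.2.trans hr₀⟩
  have hfl : ∀ x ∈ Icc δ r₀, |u' x - c * φ' x|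
      ≤ (B + |μ| * ∫ y in x..r₀, |e y|) / δ ^ (N - 1) := by
    intro x hx
    have hx1 := hsubI hx
    have hxN : 0 < x ^ (N - 1) := pow_pos hx1.1 _
    have hR := hsubI (right_mem_Icc.2 hδr)
    have hRN : 0 < r₀ ^ (N - 1) := pow_pos hR.1 _
    have h0 : radialFlux N (fun x => μ + b x) u r₀ - c * radialFlux N (fun _ => μ) φ r₀ = 0 := by
      have h1 := hu.deriv_eq hR
      have h2 := hφ.deriv_eq hR
      rw [eq_div_iff hRN.ne'] at h1 h2
      rw [← h1, ← h2, he']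
      ring
    have h1 : radialFlux N (fun x => μ + b x) u x - c * radialFlux N (fun _ => μ) φ x
        = ∫ y in Ioc x r₀, (μ * e y + b y * u y) ∂radialMeasure N := by
      have h2 := radialFlux_sub hiu hx1.1.le hx.2
      have h3 := radialFlux_sub hiφ hx1.1.le hx.2
      have h4 : ∫ y in Ioc x r₀, (μ * e y + b y * u y) ∂radialMeasure N
          = (∫ y in Ioc x r₀, (μ + b y) * u y ∂radialMeasure N)
            - c * ∫ y in Ioc x r₀, μ * φ y ∂radialMeasure N := by
        rw [← integral_const_mul, ← integral_sub hiu.integrableOn (hiφ.const_mul c).integrableOn]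
        congr 1; ext y
        simp only [hedef]
        ring
      rw [h4]
      linear_combination h0 - h2 + c * h3
    have h5 : |∫ y in Ioc x r₀, (μ * e y + b y * u y) ∂radialMeasure N|
        ≤ B + |μ| * ∫ y in x..r₀, |e y| := by
      calc |∫ y in Ioc x r₀, (μ * e y + b y * u y) ∂radialMeasure N|
          ≤ ∫ y in Ioc x r₀, (|μ| * |e y| + b y * |u y|) ∂radialMeasure N := by
            rw [← Real.norm_eq_abs]
            refine norm_integral_le_of_norm_le ?_ (Eventually.of_forall fun y => ?_)
            · refine Integrable.integrableOn (Integrable.add ?_ hibu)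
              simpa only [abs_mul] using hie.abs
            · rw [Real.norm_eq_abs, ← abs_mul]
              refine (abs_add_le _ _).trans ?_
              rw [abs_mul (b y), abs_of_nonneg (hb0 y)]
        _ = |μ| * (∫ y in Ioc x r₀, |e y| ∂radialMeasure N)
            + ∫ y in Ioc x r₀, b y * |u y| ∂radialMeasure N := by
            rw [integral_add, integral_const_mul]
            · refine Integrable.integrableOn ?_
              simpa only [abs_mul] using hie.abs
            · exact hibu.integrableOn
        _ ≤ |μ| * (∫ y in x..r₀, |e y|) + B := by
            gcongr
            · exact setIntegral_radialMeasure_le hec hx1.1.le hx.2 hr₀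
            · exact setIntegral_le_integral hibu
                (Eventually.of_forall fun y => mul_nonneg (hb0 y) (abs_nonneg _))
        _ = _ := add_comm _ _
    rw [hu.deriv_eq hx1, hφ.deriv_eq hx1, ← mul_div_assoc, ← sub_div, h1, abs_div, abs_of_pos hxN]
    gcongr
    · exact (abs_nonneg _).trans h5
    · exact hx.1
  have hii : ∀ {s t : ℝ}, s ∈ Icc δ r₀ → t ∈ Icc δ r₀ →
      IntervalIntegrable (fun y => |e y|) volume s t := fun hs ht =>
    ((hec.mono (ordConnected_Icc.uIcc_subset (Ioc_subset_Icc_self (hsubI hs))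
      (Ioc_subset_Icc_self (hsubI ht)))).abs).intervalIntegrable
  have key : ∀ s ∈ Icc δ r₀,
      |e s| ≤ B / δ ^ (N - 1) + |μ| / δ ^ (N - 1) * ∫ y in s..r₀, |e y| := by
    intro s hs
    have hI0 : 0 ≤ ∫ y in s..r₀, |e y| :=
      intervalIntegral.integral_nonneg hs.2 fun _ _ => abs_nonneg _
    set C := (B + |μ| * ∫ y in s..r₀, |e y|) / δ ^ (N - 1) with hC
    have hmv : ‖e r₀ - e s‖ ≤ C * ‖r₀ - s‖ := by
      refine Convex.norm_image_sub_le_of_norm_hasDerivWithin_le (s := Icc s r₀)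
        (f' := fun x => u' x - c * φ' x) (fun x hx => ?_) (fun x hx => ?_) (convex_Icc s r₀)
        (left_mem_Icc.2 hs.2) (right_mem_Icc.2 hs.2)
      · have hx1 := hsubI ⟨hs.1.trans hx.1, hx.2⟩
        exact ((hu.2.1 x hx1).sub ((hφ.2.1 x hx1).const_mul c)).hasDerivWithinAt
      · refine (hfl x ⟨hs.1.trans hx.1, hx.2⟩).trans ?_
        rw [hC]
        gcongr
        exact intervalIntegral.integral_mono_interval hx.1 hx.2 le_rfl
          (Eventually.of_forall fun _ => abs_nonneg _) (hii hs (right_mem_Icc.2 hδr))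
    have he0 : e r₀ = 0 := by simp [hedef, he]
    rw [he0, zero_sub, norm_neg, Real.norm_eq_abs, Real.norm_eq_abs,
      abs_of_nonneg (sub_nonneg.2 hs.2)] at hmv
    have hC0 : 0 ≤ C := by positivity
    have : C * (r₀ - s) ≤ C := mul_le_of_le_one_right hC0 (by linarith [hδ.trans_le hs.1])
    refine hmv.trans (this.trans_eq ?_)
    rw [hC]; ring
  exact le_of_le_add_mul_integral hδ.le hr₀ (by positivity) (by positivity)
    ((hec.mono (hsubI.trans Ioc_subset_Icc_self)).abs) key hr (abs_nonneg _)

theorem eq_zero_of_deriv_eq_zero (hφ : IsRadialNeumannSolutionDeriv N (fun _ => μ) φ φ') {r₀ : ℝ}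
    (hr₀ : r₀ ≤ 1) (h : φ r₀ = 0) (h' : φ' r₀ = 0) {r : ℝ} (hr : r ∈ Ioc 0 r₀) : φ r = 0 := by
  have hφ0 : IsRadialNeumannSolutionDeriv N (fun x => μ + (fun _ => 0 : ℝ → ℝ) x) φ φ' := by
    simpa using hφ
  have h1 := abs_sub_mul_le (b := fun _ => 0) (integrable_zero _ _ _) (fun _ => le_rfl) hφ0 hφ
    hr.1 hr₀ (c := 0) (by simp [h]) (by simp [h']) (left_mem_Icc.2 hr.2)
  simp only [zero_mul, integral_zero, zero_div, mul_zero, sub_zero] at h1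
  exact abs_nonpos_iff.1 h1

theorem eq_zero_of_eq_zero_left (hφ : IsRadialNeumannSolutionDeriv N (fun _ => μ) φ φ')
    (h0 : φ 0 = 0) {r : ℝ} (hr : r ∈ Icc (0 : ℝ) 1) : φ r = 0 := by
  have hiφ := integrable_mul_of_continuousOn_Icc (integrable_const μ) hφ.1 (N := N)
  have hii : ∀ {s t : ℝ}, s ∈ Icc (0 : ℝ) 1 → t ∈ Icc (0 : ℝ) 1 →
      IntervalIntegrable (fun y => |φ y|) volume s t := fun hs ht =>
    ((hφ.1.mono (ordConnected_Icc.uIcc_subset hs ht)).abs).intervalIntegrable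
  have hd : ∀ x ∈ Ioc (0 : ℝ) 1, |φ' x| ≤ |μ| * ∫ y in (0 : ℝ)..x, |φ y| := by
    intro x hx
    have hxN : 0 < x ^ (N - 1) := pow_pos hx.1 _
    rw [hφ.deriv_eq hx, abs_div, abs_of_pos hxN, div_le_iff₀ hxN, radialFlux, abs_neg,
      integral_const_mul, abs_mul, mul_assoc]
    refine mul_le_mul_of_nonneg_left ?_ (abs_nonneg _)
    refine (abs_integral_le_integral_abs).trans ?_
    rw [setIntegral_radialMeasure le_rfl hx.1.le hx.2, ← intervalIntegral.integral_mul_const]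
    have hxI : x ∈ Icc (0 : ℝ) 1 := Ioc_subset_Icc_self hx
    refine intervalIntegral.integral_mono_on hx.1.le ?_ ?_ fun y hy => ?_
    · exact (hii (by simp) hxI).continuousOn_mul (by fun_prop)
    · exact (hii (by simp) hxI).mul_const _
    · rw [mul_comm]
      gcongr
      · exact hy.1
      · exact hy.2
  have key : ∀ s ∈ Icc (0 : ℝ) 1, |φ (1 - s)| ≤ 0 + |μ| * ∫ y in s..1, |φ (1 - y)| := by
    intro s hs
    rw [intervalIntegral.integral_comp_sub_left (fun y => |φ y|), sub_self, zero_add]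
    have hI0 : 0 ≤ ∫ y in (0 : ℝ)..(1 - s), |φ y| :=
      intervalIntegral.integral_nonneg (sub_nonneg.2 hs.2) fun _ _ => abs_nonneg _
    rcases hs.2.eq_or_lt with h1 | h1
    · simp [h1, h0]
    · have hs1 : 0 < 1 - s := sub_pos.2 h1
      have hsI : 1 - s ∈ Icc (0 : ℝ) 1 := ⟨hs1.le, by linarith [hs.1]⟩
      obtain ⟨x, hx, hxd⟩ := exists_hasDerivAt_eq_slope φ φ' hs1
        (hφ.1.mono (Icc_subset_Icc_right hsI.2)) fun x hx => hφ.2.1 x ⟨hx.1, hx.2.le.trans hsI.2⟩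
      have hxI : x ∈ Ioc (0 : ℝ) 1 := ⟨hx.1, hx.2.le.trans hsI.2⟩
      have hx2 := hd x hxI
      rw [hxd, h0, sub_zero, sub_zero, abs_div, abs_of_pos hs1, div_le_iff₀ hs1] at hx2
      have h3 : ∫ y in (0 : ℝ)..x, |φ y| ≤ ∫ y in (0 : ℝ)..(1 - s), |φ y| :=
        intervalIntegral.integral_mono_interval le_rfl hx.1.le hx.2.le
          (Eventually.of_forall fun _ => abs_nonneg _) (hii (by simp) hsI)
      calc |φ (1 - s)| ≤ |μ| * (∫ y in (0 : ℝ)..x, |φ y|) * (1 - s) := hx2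
        _ ≤ |μ| * (∫ y in (0 : ℝ)..(1 - s), |φ y|) * 1 := by
          gcongr
          exact hsI.2
        _ = _ := mul_one _
  have hc : ContinuousOn (fun x => |φ (1 - x)|) (Icc 0 1) := by
    refine (hφ.1.comp (by fun_prop) fun x hx => ?_).abs
    exact ⟨by linarith [hx.2], by linarith [hx.1]⟩
  have := le_of_le_add_mul_integral le_rfl le_rfl le_rfl (abs_nonneg μ) hc key
    (r := 1 - r) ⟨by linarith [hr.2], by linarith [hr.1]⟩ (abs_nonneg _)
  simpa using this

theorem setIntegral_mul_eq {a : ℝ → ℝ} (ha : Integrable a (radialMeasure N))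
    (hu : IsRadialNeumannSolutionDeriv N a u u') {d v v' : ℝ → ℝ}
    (hd : Integrable d (radialMeasure N)) (hv : IsRadialNeumannSolutionDeriv N d v v')
    {δ : ℝ} (hδ : 0 < δ) (hδ1 : δ ≤ 1) :
    ∫ x in Ioc δ 1, a x * u x * v x ∂radialMeasure N
      = radialFlux N a u δ * v δ + ∫ x in δ..1, x ^ (N - 1) * u' x * v' x := by
  have hsub : uIcc δ 1 ⊆ Ioc 0 1 := by
    rw [uIcc_of_le hδ1]; exact fun x hx => ⟨hδ.trans_le hx.1, hx.2⟩
  have hiu := integrable_mul_of_continuousOn_Icc ha hu.1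
  set h : ℝ → ℝ := fun x => x ^ (N - 1) * (a x * u x) with hh
  have hhi : IntervalIntegrable h volume δ 1 := by
    rw [intervalIntegrable_iff, uIoc_of_le hδ1]
    exact (integrable_radialMeasure_iff.1 hiu).mono_set (Ioc_subset_Ioc_left hδ.le)
  set f : ℝ → ℝ := fun x => ∫ t in δ..x, h t with hf
  have hfP : ∀ x ∈ uIcc δ 1, f x = radialFlux N a u δ - radialFlux N a u x := by
    intro x hx
    rw [uIcc_of_le hδ1] at hx
    have := radialFlux_sub hiu hδ.le hx.1
    rw [setIntegral_radialMeasure hδ.le hx.1 hx.2] at this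
    rw [hf]; simp only [hh]
    linarith
  have hfac : AbsolutelyContinuousOnInterval f δ 1 :=
    hhi.absolutelyContinuousOnInterval_intervalIntegral left_mem_uIcc
  have hv'c : ContinuousOn v' (uIcc δ 1) := (hv.continuousOn_deriv hd).mono hsub
  obtain ⟨K, hK⟩ := isCompact_uIcc.exists_bound_of_continuousOn hv'c
  have hvac : AbsolutelyContinuousOnInterval v δ 1 := by
    refine LipschitzOnWith.absolutelyContinuousOnInterval (K := K.toNNReal) ?_
    refine Convex.lipschitzOnWith_of_nnnorm_hasDerivWithin_le (convex_uIcc δ 1)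
      (fun x hx => (hv.2.1 x (hsub hx)).hasDerivWithinAt) fun x hx => ?_
    rw [← NNReal.coe_le_coe, coe_nnnorm]
    exact (hK x hx).trans (Real.le_coe_toNNReal K)
  have hIBP := hfac.integral_mul_deriv_eq_deriv_mul hvac
  have h1 : ∫ x in δ..1, f x * deriv v x
      = radialFlux N a u δ * (v 1 - v δ) - ∫ x in δ..1, x ^ (N - 1) * u' x * v' x := by
    rw [hv.sub_eq_integral hd hδ hδ1 le_rfl, ← intervalIntegral.integral_const_mul,
      ← intervalIntegral.integral_sub]
    · refine intervalIntegral.integral_congr fun x hx => ?_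
      rw [(hv.2.1 x (hsub hx)).deriv, hfP x hx,
        ← (isRadialNeumannSolutionDeriv_iff.1 hu).2.2.1 x (hsub hx)]
      ring
    · exact (hv'c.intervalIntegrable).const_mul _
    · exact ContinuousOn.intervalIntegrable
        (((by fun_prop : ContinuousOn (fun x : ℝ => x ^ (N - 1)) _).mul
          ((hu.continuousOn_deriv ha).mono hsub)).mul hv'c)
  have h2 : ∫ x in δ..1, deriv f x * v x = ∫ x in Ioc δ 1, a x * u x * v x ∂radialMeasure N := by
    rw [setIntegral_radialMeasure hδ.le hδ1 le_rfl]
    refine intervalIntegral.integral_congr_ae ?_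
    filter_upwards [hhi.ae_hasDerivAt_integral] with x hx hxI
    rw [(hx (uIoc_subset_uIcc hxI) δ left_mem_uIcc).deriv]
    simp only [hh]
    ring
  have hf1 : f 1 = radialFlux N a u δ := by
    rw [hfP 1 right_mem_uIcc, hu.flux_one, sub_zero]
  have hf0 : f δ = 0 := by rw [hfP δ left_mem_uIcc, sub_self]
  rw [h1, h2, hf1, hf0] at hIBP
  linarith

/-- Symmetry of the energy form for two radial Neumann solutions. -/
theorem integral_mul_eq_integral_mul {a : ℝ → ℝ} (ha : Integrable a (radialMeasure N))
    (hu : IsRadialNeumannSolutionDeriv N a u u') {d v v' : ℝ → ℝ}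
    (hd : Integrable d (radialMeasure N)) (hv : IsRadialNeumannSolutionDeriv N d v v') :
    ∫ x, a x * u x * v x ∂radialMeasure N = ∫ x, d x * v x * u x ∂radialMeasure N := by
  have hiu := integrable_mul_of_continuousOn_Icc ha hu.1
  have hiv := integrable_mul_of_continuousOn_Icc hd hv.1
  have hI : Integrable (fun x => a x * u x * v x - d x * v x * u x) (radialMeasure N) :=
    (integrable_mul_of_continuousOn_Icc hiu hv.1).sub (integrable_mul_of_continuousOn_Icc hiv hu.1)
  rw [← sub_eq_zero, ← integral_sub (integrable_mul_of_continuousOn_Icc hiu hv.1)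
    (integrable_mul_of_continuousOn_Icc hiv hu.1)]
  set W : ℝ → ℝ := fun δ => radialFlux N a u δ * v δ - radialFlux N d v δ * u δ with hW
  have hWc : ContinuousOn W (Icc 0 1) :=
    ((continuousOn_radialFlux hiu).mul hv.1).sub ((continuousOn_radialFlux hiv).mul hu.1)
  have hWeq : ∀ δ ∈ Ioc (0 : ℝ) 1,
      ∫ x in δ..1, x ^ (N - 1) * (a x * u x * v x - d x * v x * u x) = W δ := by
    intro δ hδ
    have h1 := hu.setIntegral_mul_eq ha hd hv hδ.1 hδ.2
    have h2 := hv.setIntegral_mul_eq hd ha hu hδ.1 hδ.2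
    have h3 : ∫ x in δ..1, x ^ (N - 1) * u' x * v' x = ∫ x in δ..1, x ^ (N - 1) * v' x * u' x := by
      congr 1; ext x; ring
    rw [← setIntegral_radialMeasure hδ.1.le hδ.2 le_rfl, integral_sub, h1, h2, h3, hW]
    · ring
    · exact (integrable_mul_of_continuousOn_Icc hiu hv.1).integrableOn
    · exact (integrable_mul_of_continuousOn_Icc hiv hu.1).integrableOn
  have hcont : ContinuousOn
      (fun δ => ∫ x in (1 : ℝ)..δ, x ^ (N - 1) * (a x * u x * v x - d x * v x * u x))
      (Icc 0 1) := by
    have hi : IntegrableOn (fun x => x ^ (N - 1) * (a x * u x * v x - d x * v x * u x))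
        (uIcc 0 1) := by
      rw [uIcc_of_le zero_le_one, integrableOn_Icc_iff_integrableOn_Ioc]
      exact integrable_radialMeasure_iff.1 hI
    have := intervalIntegral.continuousOn_primitive_interval' (a := 1)
      hi.intervalIntegrable right_mem_uIcc
    rwa [uIcc_of_le zero_le_one] at this
  have h0 : (0 : ℝ) ∈ Icc (0 : ℝ) 1 := by simp
  have hle : nhdsWithin (0 : ℝ) (Ioc 0 1) ≤ nhdsWithin 0 (Icc 0 1) :=
    nhdsWithin_mono _ Ioc_subset_Icc_self
  have : (nhdsWithin (0 : ℝ) (Ioc 0 1)).NeBot := by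
    rw [nhdsWithin_Ioc_eq_nhdsGT one_pos]; infer_instance
  have hl1 := ((hcont 0 h0).mono_left hle).neg
  have hl2 := (hWc 0 h0).mono_left hle
  have hW0 : W 0 = 0 := by simp [hW, radialFlux_zero]
  rw [hW0] at hl2
  rw [integral_radialMeasure, intervalIntegral.integral_symm]
  refine tendsto_nhds_unique hl1 (hl2.congr' ?_)
  filter_upwards [self_mem_nhdsWithin] with δ hδ
  rw [← hWeq δ hδ, intervalIntegral.integral_symm]

end IsRadialNeumannSolutionDeriv

theorem eventually_ae_eq_zero {ι : Type*} {U : Filter ι} {b u u' : ι → ℝ → ℝ}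
    (hb : ∀ i, Integrable (b i) (radialMeasure N)) (hb0 : ∀ i x, 0 ≤ b i x)
    (hu : ∀ i, IsRadialNeumannSolutionDeriv N (fun x => μ + b i x) (u i) (u' i))
    (hφ : IsRadialNeumannSolutionDeriv N (fun _ => μ) φ φ') (hφ0 : NontrivialSol φ)
    (hz : ∀ᵐ x ∂radialMeasure N, φ x ≠ 0) (hlim : TendstoUniformlyOn u φ U (Icc 0 1))
    (hblim : Tendsto (fun i => ∫ x, b i x ∂radialMeasure N) U (nhds 0)) :
    ∀ᶠ i in U, b i =ᵐ[radialMeasure N] 0 := by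
  have hφz : φ 0 ≠ 0 := fun h => by
    obtain ⟨r, hr, hr0⟩ := hφ0
    exact hr0 (hφ.eq_zero_of_eq_zero_left h hr)
  obtain ⟨c₀, hc₀, hc⟩ : ∃ c₀ : ℝ, 0 < c₀ ∧ 2 * c₀ < |φ 0| :=
    ⟨|φ 0| / 4, by positivity, by linarith [abs_pos.2 hφz]⟩
  obtain ⟨δ, hδ, hδ1, hδφ⟩ : ∃ δ : ℝ, 0 < δ ∧ δ ≤ 1 ∧ ∀ x ∈ Icc 0 δ, 2 * c₀ < |φ x| := by
    have h0 := (hφ.1 0 (by simp)).abs.eventually_const_lt hc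
    obtain ⟨ε, hε, h⟩ := Metric.mem_nhdsWithin_iff.1 h0
    refine ⟨min (ε / 2) 1, by positivity, min_le_right _ _, fun x hx => h ⟨?_, ?_⟩⟩
    · rw [Metric.mem_ball, Real.dist_eq, sub_zero, abs_of_nonneg hx.1]
      linarith [hx.2, min_le_left (ε / 2) 1]
    · exact ⟨hx.1, hx.2.trans (min_le_right _ _)⟩
  have hφ1 : φ 1 ≠ 0 := by
    intro h
    have h2 := hδφ δ (right_mem_Icc.2 hδ.le)
    rw [hφ.eq_zero_of_deriv_eq_zero le_rfl h hφ.2.2.2 ⟨hδ, hδ1⟩, abs_zero] at h2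
    linarith
  obtain ⟨M, hM⟩ := isCompact_Icc.exists_bound_of_continuousOn hφ.1
  have hM0 : 0 ≤ M := (norm_nonneg _).trans (hM 0 (by simp))
  have hφ1' : 0 < |φ 1| := abs_pos.2 hφ1
  set C : ℝ := 2 / δ ^ (N - 1) * Real.exp (2 * (|μ| / δ ^ (N - 1)) + 1) with hC
  have hC0 : 0 < C := by positivity
  have hb1 : ∀ᶠ i in U, ∫ x, b i x ∂radialMeasure N < 1 / (2 * C) :=
    hblim.eventually_lt_const (by positivity)
  set η : ℝ := min (min c₀ |φ 1|) (c₀ / 2 / (1 + M / |φ 1|)) with hη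
  have hη0 : 0 < η := by positivity
  filter_upwards [hb1, Metric.tendstoUniformlyOn_iff.1 hlim η hη0] with i hi1 hi2
  replace hi2 : ∀ x ∈ Icc (0 : ℝ) 1, |φ x - u i x| < η := fun x hx => by
    simpa [Real.dist_eq] using hi2 x hx
  set c : ℝ := u i 1 / φ 1 with hcdef
  have hu1 : u i 1 = c * φ 1 := by rw [hcdef, div_mul_cancel₀ _ hφ1]
  have hu1' : u' i 1 = c * φ' 1 := by rw [(hu i).2.2.2, hφ.2.2.2, mul_zero]
  have hc0 : c ≠ 0 := by
    refine div_ne_zero (fun h => ?_) hφ1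
    have := hi2 1 (by simp)
    rw [h, sub_zero] at this
    exact absurd (this.trans_le ((min_le_left _ _).trans (min_le_right _ _))) (lt_irrefl _)
  set e : ℝ → ℝ := fun x => u i x - c * φ x with he
  have hesmall : ∀ x ∈ Icc (0 : ℝ) 1, |e x| ≤ c₀ / 2 := by
    intro x hx
    have h1 : |1 - c| ≤ η / |φ 1| := by
      rw [le_div_iff₀ hφ1', ← abs_mul, sub_mul, one_mul, ← hu1]
      exact (hi2 1 (by simp)).le
    calc |e x| = |(1 - c) * φ x - (φ x - u i x)| := by rw [he]; congr 1; ring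
      _ ≤ |(1 - c) * φ x| + |φ x - u i x| := abs_sub _ _
      _ ≤ η / |φ 1| * M + η := by
          rw [abs_mul]
          exact add_le_add (mul_le_mul h1 (hM x hx) (abs_nonneg _) (by positivity)) (hi2 x hx).le
      _ = η * (1 + M / |φ 1|) := by ring
      _ ≤ c₀ / 2 := (le_div_iff₀ (by positivity)).1 (min_le_right _ _)
  set B : ℝ := ∫ x, b i x * |u i x| ∂radialMeasure N with hB
  set β : ℝ := ∫ x, b i x ∂radialMeasure N with hβ
  set A : ℝ := ∫ x, b i x * u i x * u i x ∂radialMeasure N with hA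
  have hbu := integrable_mul_of_continuousOn_Icc (hb i) (hu i).1
  have hbabs := integrable_mul_of_continuousOn_Icc (hb i) (hu i).1.abs
  have hbuu := integrable_mul_of_continuousOn_Icc hbu (hu i).1
  have hbuφ := integrable_mul_of_continuousOn_Icc hbu hφ.1
  have hμu := integrable_mul_of_continuousOn_Icc (integrable_const μ) (hu i).1 (N := N)
  have hμuφ := integrable_mul_of_continuousOn_Icc hμu hφ.1
  have hB0 : 0 ≤ B := integral_nonneg fun x => mul_nonneg (hb0 i x) (abs_nonneg _)
  have heB : ∀ x ∈ Icc δ 1, |e x| ≤ C * B := by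
    intro x hx
    refine ((hu i).abs_sub_mul_le (hb i) (hb0 i) hφ hδ le_rfl hu1 hu1' hx).trans_eq ?_
    rw [hC]; ring
  have horth : ∫ x, b i x * u i x * φ x ∂radialMeasure N = 0 := by
    have h1 : ∫ x, (μ + b i x) * u i x * φ x ∂radialMeasure N
        = ∫ x, μ * φ x * u i x ∂radialMeasure N :=
      (hu i).integral_mul_eq_integral_mul ((integrable_const μ).add (hb i))
        (integrable_const μ) hφ
    have h2 : ∫ x, (μ + b i x) * u i x * φ x ∂radialMeasure N
        = ∫ x, μ * u i x * φ x ∂radialMeasure N + ∫ x, b i x * u i x * φ x ∂radialMeasure N := by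
      rw [← integral_add hμuφ hbuφ]
      congr 1; ext x; ring
    have h3 : ∫ x, μ * φ x * u i x ∂radialMeasure N = ∫ x, μ * u i x * φ x ∂radialMeasure N := by
      congr 1; ext x; ring
    rw [h2, h3] at h1
    linarith
  have hAe : A ≤ A / 2 + C * B * B := by
    calc A = ∫ x, (b i x * u i x * u i x - c * (b i x * u i x * φ x)) ∂radialMeasure N := by
          rw [integral_sub hbuu (hbuφ.const_mul c), integral_const_mul, horth, mul_zero, sub_zero]
      _ ≤ ∫ x, (1 / 2 * (b i x * u i x * u i x) + C * B * (b i x * |u i x|))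
            ∂radialMeasure N := by
          refine integral_mono_ae (hbuu.sub (hbuφ.const_mul c))
            ((hbuu.const_mul _).add (hbabs.const_mul _)) ?_
          filter_upwards [ae_mem_Ioc_radialMeasure N] with x hx
          have h1 : b i x * u i x * u i x - c * (b i x * u i x * φ x)
              ≤ b i x * |u i x| * |e x| := by
            rw [mul_assoc (b i x) |u i x|, ← abs_mul]
            have := mul_le_mul_of_nonneg_left (le_abs_self (u i x * e x)) (hb0 i x)
            refine le_trans (le_of_eq ?_) this
            rw [he]; ring
          refine h1.trans ?_
          have hbx := mul_nonneg (hb0 i x) (abs_nonneg (u i x))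
          have hsq : b i x * u i x * u i x = b i x * |u i x| * |u i x| := by
            rw [mul_assoc, mul_assoc, abs_mul_abs_self]
          rw [hsq]
          rcases le_total x δ with hxδ | hxδ
          · have h2 := hδφ x ⟨hx.1.le, hxδ⟩
            have h3 := (hi2 x (Ioc_subset_Icc_self hx)).trans_le
              ((min_le_left _ _).trans (min_le_left _ _))
            have h4 := hesmall x (Ioc_subset_Icc_self hx)
            have h5 := abs_sub_abs_le_abs_sub (φ x) (u i x)
            have h6 : |e x| ≤ |u i x| / 2 := by linarith
            have h7 : 0 ≤ C * B * (b i x * |u i x|) := by positivity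
            have := mul_le_mul_of_nonneg_left h6 hbx
            linarith
          · have h6 := heB x ⟨hxδ, hx.2⟩
            have := mul_le_mul_of_nonneg_left h6 hbx
            have h7 := mul_nonneg hbx (abs_nonneg (u i x))
            linarith
      _ = A / 2 + C * B * B := by
          rw [integral_add (hbuu.const_mul _) (hbabs.const_mul _), integral_const_mul,
            integral_const_mul]
          ring
  have hCS : 0 ≤ A - 2 * (2 * C * B) * B + (2 * C * B) ^ 2 * β := by
    calc 0 ≤ ∫ x, b i x * (|u i x| - 2 * C * B) ^ 2 ∂radialMeasure N :=
          integral_nonneg fun x => mul_nonneg (hb0 i x) (sq_nonneg _)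
      _ = ∫ x, (b i x * u i x * u i x - 2 * (2 * C * B) * (b i x * |u i x|)
            + (2 * C * B) ^ 2 * b i x) ∂radialMeasure N := by
          congr 1; ext x
          have := abs_mul_abs_self (u i x)
          linear_combination b i x * this
      _ = _ := by
          have hbint : Integrable (fun x => b i x * u i x * u i x
              - 2 * (2 * C * B) * (b i x * |u i x|)) (radialMeasure N) :=
            hbuu.sub (hbabs.const_mul _)
          rw [integral_add hbint ((hb i).const_mul _),
            integral_sub hbuu (hbabs.const_mul _), integral_const_mul, integral_const_mul]
  have hB2 : B = 0 := by
    have h1 : β * (2 * C) < 1 := (lt_div_iff₀ (by positivity)).1 hi1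
    have h2 : 2 * C * (B * B) * (1 - β * (2 * C)) ≤ 0 := by nlinarith
    by_contra hne
    have h3 : 0 < 2 * C * (B * B) * (1 - β * (2 * C)) := by
      have : 0 < B := lt_of_le_of_ne hB0 (Ne.symm hne)
      have : 0 < 1 - β * (2 * C) := by linarith
      positivity
    linarith
  have hueq : ∀ x ∈ Ioc (0 : ℝ) 1, u i x = c * φ x := by
    intro x hx
    have := (hu i).abs_sub_mul_le (hb i) (hb0 i) hφ hx.1 le_rfl hu1 hu1' (left_mem_Icc.2 hx.2)
    rw [← hB, hB2, zero_div, mul_zero, zero_mul] at this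
    exact sub_eq_zero.1 (abs_nonpos_iff.1 this)
  have hae := (integral_eq_zero_iff_of_nonneg
    (fun x => mul_nonneg (hb0 i x) (abs_nonneg _)) hbabs).1 hB2
  filter_upwards [hae, ae_mem_Ioc_radialMeasure N, hz] with x h1 h2 h3
  rw [hueq x h2] at h1
  simpa [hc0, h3] using h1

end Perturbation

theorem radialMemLp_of_bounded {N : ℕ} {a : ℝ → ℝ} (ha : Measurable a) {C : ℝ}
    (hC : ∀ r ∈ Ioo (0 : ℝ) 1, |a r| ≤ C) {p : ℝ} (hp : 0 ≤ p) : RadialMemLp N p a := by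
  refine Measure.integrableOn_of_bounded (M := C ^ p) (by simp)
    (Measurable.aestronglyMeasurable (by fun_prop)) ?_
  filter_upwards [ae_restrict_mem measurableSet_Ioo] with r hr
  have h1 : 0 ≤ |a r| ^ p := by positivity
  rw [Real.norm_eq_abs, abs_mul, abs_of_nonneg h1, abs_of_nonneg (pow_nonneg hr.1.le _)]
  calc r ^ (N - 1) * |a r| ^ p ≤ 1 * |a r| ^ p := by
        gcongr
        exact pow_le_one₀ hr.1.le hr.2.le
    _ ≤ C ^ p := by
        rw [one_mul]
        gcongr
        exact hC r hr

theorem exists_oscillation_frequency (α β : ℝ) {T : ℝ} (hT : 0 < T) (R : ℝ) :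
    ∃ s : ℝ, R < s ∧ -(α * s * Real.sin (s * T)) + β * Real.cos (s * T) = 0 := by
  obtain ⟨n, hn⟩ := exists_nat_gt (max R 0 * T)
  set G : ℝ → ℝ := fun s => -(α * s * Real.sin (s * T)) + β * Real.cos (s * T) with hG
  have hGc : Continuous G := by fun_prop
  set s₁ : ℝ := (Real.pi / 2 + n * (2 * Real.pi)) / T with hs₁
  set s₂ : ℝ := (Real.pi + Real.pi / 2 + n * (2 * Real.pi)) / T with hs₂
  have hpi := Real.pi_gt_three
  have hle : s₁ ≤ s₂ := by rw [hs₁, hs₂]; gcongr; linarith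
  have hn0 : (0 : ℝ) ≤ n := by positivity
  have hR : max R 0 < s₁ := by
    rw [hs₁, lt_div_iff₀ hT]
    nlinarith
  have h1 : G s₁ = -(α * s₁) := by
    simp only [hG]
    rw [show s₁ * T = Real.pi / 2 + n * (2 * Real.pi) by rw [hs₁, div_mul_cancel₀ _ hT.ne'],
      Real.sin_add_nat_mul_two_pi, Real.cos_add_nat_mul_two_pi]
    simp
  have h2 : G s₂ = α * s₂ := by
    simp only [hG]
    rw [show s₂ * T = Real.pi + Real.pi / 2 + n * (2 * Real.pi) by
      rw [hs₂, div_mul_cancel₀ _ hT.ne'],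
      Real.sin_add_nat_mul_two_pi, Real.cos_add_nat_mul_two_pi, add_comm Real.pi,
      Real.sin_add_pi, Real.cos_add_pi]
    simp
  have hs1 : 0 < s₁ := (le_max_right R 0).trans_lt hR
  have hs2 : 0 < s₂ := hs1.trans_le hle
  have hex : ∃ s ∈ Icc s₁ s₂, G s = 0 := by
    rcases le_total 0 α with h | h
    · refine intermediate_value_Icc hle hGc.continuousOn ⟨?_, ?_⟩
      · rw [h1]; exact neg_nonpos.2 (mul_nonneg h hs1.le)
      · rw [h2]; exact mul_nonneg h hs2.le
    · refine intermediate_value_Icc' hle hGc.continuousOn ⟨?_, ?_⟩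
      · rw [h2]; exact mul_nonpos_of_nonpos_of_nonneg h hs2.le
      · rw [h1]; exact neg_nonneg.2 (mul_nonpos_of_nonpos_of_nonneg h hs1.le)
  obtain ⟨s, hs, hs0⟩ := hex
  exact ⟨s, (le_max_left R 0).trans_lt (hR.trans_le hs.1), hs0⟩

/-- An eigenfunction can be continued past `r₀` by an oscillating solution of the equation with
coefficient `s ^ 2 / r ^ (2 N - 2)`, so that the result is again a Neumann solution. -/
theorem IsRadialNeumannSolutionDeriv.exists_continuation {N : ℕ} {μ : ℝ} {φ φ' : ℝ → ℝ}
    (hφ : IsRadialNeumannSolutionDeriv N (fun _ => μ) φ φ') {r₀ : ℝ} (hr₀ : r₀ ∈ Ioo (0 : ℝ) 1)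
    (R : ℝ) :
    ∃ s u u' : ℝ → ℝ, (∃ s₀ : ℝ, R < s₀ ∧ s = fun r => s₀ ^ 2 / (r ^ (N - 1)) ^ 2) ∧ u 0 = φ 0 ∧
      IsRadialNeumannSolutionDeriv N (fun r => if r ≤ r₀ then μ else s r) u u' := by
  have hr₀I : r₀ ∈ Ioc (0 : ℝ) 1 := ⟨hr₀.1, hr₀.2.le⟩
  set α := φ r₀ with hα
  set β := r₀ ^ (N - 1) * φ' r₀ with hβ
  set τ : ℝ → ℝ := fun r => ∫ x in r₀..r, (x ^ (N - 1))⁻¹ with hτ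
  have hcinv : ContinuousOn (fun x : ℝ => (x ^ (N - 1))⁻¹) (Ioi 0) :=
    ContinuousOn.inv₀ (by fun_prop) fun x hx => (pow_pos hx _).ne'
  have hτd : ∀ r, 0 < r → HasDerivAt τ (r ^ (N - 1))⁻¹ r := by
    intro r hr
    refine intervalIntegral.integral_hasDerivAt_right ?_ ?_ ?_
    · exact (hcinv.mono (ordConnected_Ioi.uIcc_subset hr₀.1 hr)).intervalIntegrable
    · exact hcinv.stronglyMeasurableAtFilter isOpen_Ioi r hr
    · exact hcinv.continuousAt (Ioi_mem_nhds hr)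
  have hτ0 : τ r₀ = 0 := by simp [hτ]
  have hτ1 : 0 < τ 1 := by
    refine intervalIntegral.intervalIntegral_pos_of_pos_on ?_
      (fun x hx => inv_pos.2 (pow_pos (hr₀.1.trans hx.1) _)) hr₀.2
    exact (hcinv.mono (ordConnected_Ioi.uIcc_subset hr₀.1
      (mem_Ioi.2 one_pos))).intervalIntegrable
  obtain ⟨s, hs, hs1⟩ := exists_oscillation_frequency α β hτ1 (max R 0)
  have hs0 : 0 < s := (le_max_right R 0).trans_lt hs
  set y : ℝ → ℝ := fun t => α * Real.cos (s * t) + β / s * Real.sin (s * t) with hy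
  set z : ℝ → ℝ := fun t => -(α * s * Real.sin (s * t)) + β * Real.cos (s * t) with hz
  have hyd : ∀ t, HasDerivAt y (z t) t := by
    intro t
    have h1 : HasDerivAt (fun t => s * t) s t := by
      simpa using (hasDerivAt_id t).const_mul s
    have h2 := (h1.cos.const_mul α).add (h1.sin.const_mul (β / s))
    convert! h2 using 1
    simp only [hz]
    field_simp
  have hzd : ∀ t, HasDerivAt z (-(s ^ 2 * y t)) t := by
    intro t
    have h1 : HasDerivAt (fun t => s * t) s t := by
      simpa using (hasDerivAt_id t).const_mul s
    have h2 := (h1.sin.const_mul (α * s)).neg.add (h1.cos.const_mul β)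
    convert! h2 using 1
    simp only [hy]
    field_simp
    ring
  have hy0 : y 0 = α := by simp [hy]
  have hz0 : z 0 = β := by simp [hz]
  have hz1 : z (τ 1) = 0 := hs1
  set u : ℝ → ℝ := fun r => if r ≤ r₀ then φ r else y (τ r) with hu
  set u' : ℝ → ℝ := fun r => if r ≤ r₀ then φ' r else z (τ r) * (r ^ (N - 1))⁻¹ with hu'
  have hyτ : ∀ r, 0 < r → HasDerivAt (fun r => y (τ r)) (z (τ r) * (r ^ (N - 1))⁻¹) r :=
    fun r hr => (hyd (τ r)).comp r (hτd r hr)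
  have huφ : EqOn u φ (Iic r₀) := fun r hr => if_pos hr
  have huy : EqOn u (fun r => y (τ r)) (Ici r₀) := by
    intro r hr
    rcases (mem_Ici.1 hr).eq_or_lt with h | h
    · simp only [hu, ← h, le_refl, if_true, hτ0, hy0, hα]
    · simp only [hu, not_le.2 h, if_false]
  have hud : ∀ r ∈ Ioc (0 : ℝ) 1, HasDerivAt u (u' r) r := by
    intro r hr
    rcases lt_trichotomy r r₀ with h | h | h
    · simp only [hu', h.le, if_true]
      exact (hφ.2.1 r hr).congr_of_eventuallyEq
        (Filter.eventuallyEq_of_mem (Iic_mem_nhds h) huφ)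
    · subst h
      have h1 : HasDerivWithinAt u (φ' r) (Iic r) r :=
        (hφ.2.1 r hr).hasDerivWithinAt.congr huφ (huφ self_mem_Iic)
      have h2 : HasDerivWithinAt u (φ' r) (Ici r) r := by
        have h3 := (hyτ r hr.1).hasDerivWithinAt.congr huy (huy self_mem_Ici)
        rwa [hτ0, hz0, hβ, mul_comm, inv_mul_cancel_left₀ (pow_pos hr.1 _).ne'] at h3
      simpa [hu', Iic_union_Ici] using h1.union h2
    · simp only [hu', not_le.2 h, if_false]
      exact (hyτ r hr.1).congr_of_eventuallyEq
        (Filter.eventuallyEq_of_mem (Ici_mem_nhds h) huy)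
  have huc : ContinuousOn u (Icc 0 1) := by
    intro r hr
    rcases hr.1.eq_or_lt with h | h
    · subst h
      have h1 : ContinuousWithinAt φ (Icc 0 1) 0 := hφ.1 0 hr
      exact h1.congr_of_eventuallyEq
        (Filter.eventuallyEq_of_mem (mem_nhdsWithin_of_mem_nhds (Iic_mem_nhds hr₀.1)) huφ)
        (huφ hr₀.1.le)
    · exact (hud r ⟨h, hr.2⟩).continuousAt.continuousWithinAt
  refine ⟨_, u, u', ⟨s, (le_max_left R 0).trans_lt hs, rfl⟩, huφ hr₀.1.le,
    isRadialNeumannSolutionDeriv_iff.2 ⟨huc, hud, ?_, ?_⟩⟩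
  · set a : ℝ → ℝ := fun r => if r ≤ r₀ then μ else s ^ 2 / (r ^ (N - 1)) ^ 2 with ha
    have hleft : ∀ r ∈ Ioc (0 : ℝ) r₀, radialFlux N a u r = r ^ (N - 1) * φ' r := by
      intro r hr
      rw [(isRadialNeumannSolutionDeriv_iff.1 hφ).2.2.1 r ⟨hr.1, hr.2.trans hr₀.2.le⟩]
      simp only [radialFlux]
      congr 1
      refine setIntegral_congr_fun measurableSet_Ioc fun x hx => ?_
      have hxr : x ≤ r₀ := hx.2.trans hr.2
      simp only [ha, hu, hxr, if_true]
    intro r hr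
    rcases le_or_gt r r₀ with h | h
    · rw [hleft r ⟨hr.1, h⟩]
      simp only [hu', h, if_true]
    · have hrN : r ^ (N - 1) ≠ 0 := (pow_pos hr.1 _).ne'
      have hpos : ∀ x ∈ uIcc r₀ r, 0 < x := fun x hx => by
        rw [uIcc_of_le h.le] at hx
        exact hr₀.1.trans_le hx.1
      have hI : ∫ x in r₀..r, -(s ^ 2 * y (τ x)) * (x ^ (N - 1))⁻¹ = z (τ r) - z (τ r₀) := by
        refine intervalIntegral.integral_eq_sub_of_hasDerivAt
          (f := fun r => z (τ r)) (fun x hx => (hzd (τ x)).comp x (hτd x (hpos x hx))) ?_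
        refine ContinuousOn.intervalIntegrable (ContinuousOn.mul ?_
          (hcinv.mono hpos))
        exact (continuousOn_const.mul fun x hx =>
          (hyτ x (hpos x hx)).continuousAt.continuousWithinAt).neg
      have hbdd : ∀ x ∈ Ioc (0 : ℝ) 1, |a x| ≤ |μ| + s ^ 2 / (r₀ ^ (N - 1)) ^ 2 := by
        intro x hx
        have h1 : 0 < (r₀ ^ (N - 1)) ^ 2 := pow_pos (pow_pos hr₀.1 _) _
        rcases le_or_gt x r₀ with h' | h'
        · simp only [ha, h', if_true]
          exact le_add_of_nonneg_right (by positivity)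
        · simp only [ha, not_le.2 h', if_false]
          rw [abs_of_nonneg (by positivity)]
          refine le_add_of_nonneg_of_le (abs_nonneg _) ?_
          have := hr₀.1.le
          gcongr
      have ham : Measurable a := Measurable.ite measurableSet_Iic measurable_const (by fun_prop)
      have hai : Integrable a (radialMeasure N) := by
        refine Integrable.of_bound ham.aestronglyMeasurable (|μ| + s ^ 2 / (r₀ ^ (N - 1)) ^ 2) ?_
        exact (ae_mem_Ioc_radialMeasure N).mono hbdd
      have h1 := radialFlux_sub (integrable_mul_of_continuousOn_Icc hai huc) hr₀.1.le h.le
      rw [setIntegral_radialMeasure hr₀.1.le h.le hr.2, hleft r₀ ⟨hr₀.1, le_rfl⟩, ← hβ] at h1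
      have h2 : ∫ x in r₀..r, x ^ (N - 1) * (a x * u x)
          = -∫ x in r₀..r, -(s ^ 2 * y (τ x)) * (x ^ (N - 1))⁻¹ := by
        rw [← intervalIntegral.integral_neg]
        refine intervalIntegral.integral_congr_ae (Eventually.of_forall fun x hx => ?_)
        have hxN : x ^ (N - 1) ≠ 0 := (pow_pos (hpos x (uIoc_subset_uIcc hx)) _).ne'
        rw [uIoc_of_le h.le] at hx
        rw [huy hx.1.le]
        simp only [ha, not_le.2 hx.1, if_false]
        field_simp
      rw [h2, hI, hτ0, hz0] at h1
      simp only [hu', not_le.2 h, if_false]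
      rw [mul_comm, inv_mul_cancel_right₀ hrN]
      linarith
  · simp only [hu', not_le.2 hr₀.2, if_false, hz1, zero_mul]

theorem exists_gammaSet_radialMemLp {N : ℕ} {μ : ℝ} {φ : ℝ → ℝ} (hμ : 0 ≤ μ)
    (hφ : IsRadialNeumannSolution N (fun _ => μ) φ) (hφ0 : NontrivialSol φ) :
    ∃ a, GammaSet N μ a ∧ ∀ p : ℝ, 0 ≤ p → RadialMemLp N p a := by
  obtain ⟨φ', hφ⟩ := hφ
  have hφz : φ 0 ≠ 0 := fun h => by
    obtain ⟨r, hr, hr0⟩ := hφ0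
    exact hr0 (hφ.eq_zero_of_eq_zero_left h hr)
  obtain ⟨_, u, u', ⟨s, hs, rfl⟩, hu0, hu⟩ :=
    hφ.exists_continuation (r₀ := 1 / 2) ⟨by norm_num, by norm_num⟩ (μ + 1)
  set a : ℝ → ℝ := fun r => if r ≤ 1 / 2 then μ else s ^ 2 / (r ^ (N - 1)) ^ 2 with ha
  have ham : Measurable a := Measurable.ite measurableSet_Iic measurable_const (by fun_prop)
  have hgt : ∀ r ∈ Ioo (1 / 2 : ℝ) 1, μ < a r := by
    intro r hr
    simp only [ha, not_le.2 hr.1, if_false]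
    have h0 : 0 < r := lt_trans (by norm_num) hr.1
    have h1 : (r ^ (N - 1)) ^ 2 ≤ 1 := pow_le_one₀ (by positivity) (pow_le_one₀ h0.le hr.2.le)
    rw [lt_div_iff₀ (by positivity)]
    nlinarith [mul_le_mul_of_nonneg_left h1 hμ]
  have hbdd : ∀ r ∈ Ioo (0 : ℝ) 1, |a r| ≤ μ + s ^ 2 / ((1 / 2) ^ (N - 1)) ^ 2 := by
    intro r hr
    rcases le_or_gt r (1 / 2) with h | h
    · simp only [ha, h, if_true, abs_of_nonneg hμ]
      exact le_add_of_nonneg_right (by positivity)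
    · simp only [ha, not_le.2 h, if_false]
      rw [abs_of_nonneg (by positivity)]
      refine le_add_of_nonneg_of_le hμ ?_
      gcongr
  have hp : ∀ p : ℝ, 0 ≤ p → RadialMemLp N p a := fun p hp => radialMemLp_of_bounded ham hbdd hp
  refine ⟨a, ⟨ham, ⟨?_, ?_⟩, ⟨u, ⟨u', hu⟩, 0, by simp, hu0 ▸ hφz⟩, ?_⟩, hp⟩
  · filter_upwards [ae_restrict_mem measurableSet_Ioo] with r hr
    rcases le_or_gt r (1 / 2) with h | h
    · simp only [ha, h, if_true, le_refl]
    · exact (hgt r ⟨h, hr.2⟩).le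
  · refine lt_of_lt_of_le ?_ (measure_mono fun r (hr : r ∈ Ioo (1 / 2 : ℝ) 1) =>
      ⟨⟨lt_trans (by norm_num) hr.1, hr.2⟩, hgt r hr⟩)
    rw [Real.volume_Ioo]
    norm_num
  · split_ifs
    · exact hp _ (by positivity)
    · exact Or.inr ⟨_, (ae_restrict_mem measurableSet_Ioo).mono hbdd⟩

theorem IsRadialNeumannSolutionDeriv.ae_ne_zero {N : ℕ} {μ : ℝ} {φ φ' : ℝ → ℝ}
    (hφ : IsRadialNeumannSolutionDeriv N (fun _ => μ) φ φ') (h0 : NontrivialSol φ) :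
    ∀ᵐ x ∂radialMeasure N, φ x ≠ 0 := by
  have hd : ∀ x ∈ Ioc (0 : ℝ) 1, φ x = 0 → φ' x ≠ 0 := by
    intro x hx h h'
    have hz : ∀ δ ∈ Ioc (0 : ℝ) x, φ δ = 0 := fun δ hδ => hφ.eq_zero_of_deriv_eq_zero hx.2 h h' hδ
    have h00 : φ 0 = 0 := by
      have hsub : Ioc 0 x ⊆ Icc (0 : ℝ) 1 := fun y hy => ⟨hy.1.le, hy.2.trans hx.2⟩
      have h1 : Tendsto φ (nhdsWithin 0 (Ioc 0 x)) (nhds (φ 0)) :=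
        (hφ.1 0 (by simp)).mono_left (nhdsWithin_mono _ hsub)
      have h2 : Tendsto φ (nhdsWithin 0 (Ioc 0 x)) (nhds 0) :=
        tendsto_const_nhds.congr' (eventually_nhdsWithin_of_forall fun y hy => (hz y hy).symm)
      have : (nhdsWithin (0 : ℝ) (Ioc 0 x)).NeBot := by
        rw [nhdsWithin_Ioc_eq_nhdsGT hx.1]; infer_instance
      exact tendsto_nhds_unique h1 h2
    obtain ⟨r, hr, hr0⟩ := h0
    exact hr0 (hφ.eq_zero_of_eq_zero_left h00 hr)
  have hnull : volume {x ∈ Ioc (0 : ℝ) 1 | φ x = 0} = 0 := by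
    refine measure_null_of_locally_null _ fun x hx => ⟨{x}, ?_, by simp⟩
    have h1 := (hφ.2.1 x hx.1).eventually_ne (hd x hx.1 hx.2) (c := 0)
    rw [eventually_nhdsWithin_iff] at h1
    filter_upwards [mem_nhdsWithin_of_mem_nhds h1, self_mem_nhdsWithin] with z hz hzs
    by_contra hne
    exact hz hne hzs.2
  rw [ae_radialMeasure_iff, ae_restrict_iff' measurableSet_Ioc, ae_iff]
  convert hnull using 2
  ext x; simp [and_assoc]

theorem ae_restrict_Ioo_iff {N : ℕ} {P : ℝ → Prop} :
    (∀ᵐ r ∂volume.restrict (Ioo (0 : ℝ) 1), P r) ↔ ∀ᵐ r ∂radialMeasure N, P r := by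
  rw [ae_radialMeasure_iff, Measure.restrict_congr_set Ioo_ae_eq_Ioc]

theorem prec_iff {N : ℕ} {μ : ℝ} {a : ℝ → ℝ} :
    Prec μ a ↔ (∀ᵐ r ∂radialMeasure N, μ ≤ a r) ∧ ¬∀ᵐ r ∂radialMeasure N, a r ≤ μ := by
  have : {x | ¬(x ∈ Ioo (0 : ℝ) 1 → a x ≤ μ)} = {r ∈ Ioo (0 : ℝ) 1 | μ < a r} := by
    ext x; simp [and_assoc]
  rw [Prec, ae_restrict_Ioo_iff (N := N), ← ae_restrict_Ioo_iff (N := N) (P := fun r => a r ≤ μ),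
    ae_restrict_iff' measurableSet_Ioo, ae_iff (p := fun x => x ∈ Ioo (0 : ℝ) 1 → a x ≤ μ), this,
    pos_iff_ne_zero]

theorem radialMemLp_iff {N : ℕ} {p : ℝ} (hp : 0 < p) {a : ℝ → ℝ} (ha : Measurable a) :
    RadialMemLp N p a ↔ MemLp a (ENNReal.ofReal p) (radialMeasure N) := by
  have h := integrable_norm_rpow_iff (μ := radialMeasure N) (f := a) (p := ENNReal.ofReal p)
    ha.aestronglyMeasurable (by simpa using hp) ENNReal.ofReal_ne_top
  rw [← h, ENNReal.toReal_ofReal hp.le, integrable_radialMeasure_iff,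
    integrableOn_Ioc_iff_integrableOn_Ioo]
  rfl

theorem radialLpNorm_eq {N : ℕ} {p : ℝ} {a : ℝ → ℝ} :
    radialLpNorm N p a = (omegaN N * ∫ x, |a x| ^ p ∂radialMeasure N) ^ (1 / p) := by
  rw [radialLpNorm, integral_radialMeasure]

theorem omegaN_pos {N : ℕ} (hN : 1 ≤ N) : 0 < omegaN N := by
  refine mul_pos (by exact_mod_cast hN) (ENNReal.toReal_pos ?_ measure_ball_lt_top.ne)
  exact (Metric.measure_ball_pos _ _ one_pos).ne'

theorem integral_abs_add_rpow_le {X : Type*} [MeasurableSpace X] {ρ : Measure X}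
    {p : ℝ} (hp : 1 ≤ p) {f g : X → ℝ} (hf : MemLp f (ENNReal.ofReal p) ρ)
    (hg : MemLp g (ENNReal.ofReal p) ρ) :
    ∫ x, |f x + g x| ^ p ∂ρ ≤ 2 ^ (p - 1) * (∫ x, |f x| ^ p ∂ρ + ∫ x, |g x| ^ p ∂ρ) := by
  have hp0 : 0 < p := by linarith
  have hi : ∀ {f : X → ℝ}, MemLp f (ENNReal.ofReal p) ρ → Integrable (fun x => |f x| ^ p) ρ := by
    intro f hf
    have := hf.integrable_norm_rpow (by simpa using hp0) ENNReal.ofReal_ne_top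
    simpa [ENNReal.toReal_ofReal hp0.le] using this
  rw [← integral_add (hi hf) (hi hg), ← integral_const_mul]
  refine integral_mono (hi (hf.add hg)) (((hi hf).add (hi hg)).const_mul _) fun x => ?_
  have h1 := NNReal.rpow_add_le_mul_rpow_add_rpow ‖f x‖₊ ‖g x‖₊ hp
  have h2 : (‖f x‖ + ‖g x‖) ^ p ≤ 2 ^ (p - 1) * (‖f x‖ ^ p + ‖g x‖ ^ p) := by
    exact_mod_cast h1
  refine le_trans ?_ h2
  exact Real.rpow_le_rpow (abs_nonneg _) (abs_add_le _ _) hp0.le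

/-- Limits of nonnegative perturbations of the coefficient `μ` that admit nontrivial solutions are
again perturbations with this property, and they do not vanish. -/
theorem exists_limit_perturbation {ι : Type*} (U : Ultrafilter ι) {N : ℕ} (hN : 1 ≤ N)
    {p q μ K C : ℝ} (hpq : p.HolderConjugate q) (hp : (N : ℝ) / 2 < p) {b : ι → ℝ → ℝ}
    (hb0 : ∀ i x, 0 ≤ b i x) (hb : ∀ i, MemLp (b i) (ENNReal.ofReal p) (radialMeasure N))
    (hK : ∀ i, ∫ x, |b i x| ^ p ∂radialMeasure N ≤ K)
    (hC : Tendsto (fun i => ∫ x, |b i x| ^ p ∂radialMeasure N) U (nhds C))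
    (hne : ∀ i, ¬b i =ᵐ[radialMeasure N] 0)
    (hu : ∀ i, ∃ u, IsRadialNeumannSolution N (fun x => μ + b i x) u ∧ NontrivialSol u) :
    ∃ B : ℝ → ℝ, Measurable B ∧ (∀ x, 0 ≤ B x) ∧ MemLp B (ENNReal.ofReal p) (radialMeasure N) ∧
      ¬B =ᵐ[radialMeasure N] 0 ∧ ∫ x, |B x| ^ p ∂radialMeasure N ≤ C ∧
      ∃ u, IsRadialNeumannSolution N (fun x => μ + B x) u ∧ NontrivialSol u := by
  have hp1 : 1 ≤ ENNReal.ofReal p := by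
    rw [← ENNReal.ofReal_one]; exact ENNReal.ofReal_le_ofReal hpq.lt.le
  have hbint : ∀ i, Integrable (b i) (radialMeasure N) := fun i => (hb i).integrable hp1
  obtain ⟨B, hBm, hB0, hBi, hlim⟩ :=
    exists_density_of_bounded hpq U hb0 hb (Eventually.of_forall hK)
  obtain ⟨hBp, hBC⟩ :=
    memLp_of_tendsto_setIntegral hpq hb hBi hBm hB0 hlim (fun _ => le_rfl) hC
  have hw : ∀ i, ∃ v v', IsRadialNeumannSolutionDeriv N (fun x => μ + b i x) v v' ∧
      (∀ r ∈ Icc (0 : ℝ) 1, |v r| ≤ 1) ∧ ∃ r ∈ Icc (0 : ℝ) 1, |v r| = 1 := by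
    intro i
    obtain ⟨u, ⟨u', hu'⟩, h0⟩ := hu i
    exact hu'.exists_normalized h0
  choose v v' hv hv1 x hx hvx using hw
  have hconst : MemLp (fun _ => μ) (ENNReal.ofReal p) (radialMeasure N) := memLp_const μ
  obtain ⟨w, w', hw, hvw⟩ := exists_limit_solution U hN hpq hp
    (a := fun i x => μ + b i x) (A := fun x => μ + B x)
    (fun i => hconst.add (hb i))
    (fun i => (integral_abs_add_rpow_le hpq.lt.le hconst (hb i)).trans
      (mul_le_mul_of_nonneg_left (add_le_add_right (hK i) _) (by positivity)))
    (hconst.add hBp) (fun g hg => by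
      have hq1 : 1 ≤ ENNReal.ofReal q := by
        rw [← ENNReal.ofReal_one]; exact ENNReal.ofReal_le_ofReal hpq.symm.lt.le
      have hc : (ENNReal.ofReal q).HolderConjugate (ENNReal.ofReal p) := hpq.symm.ennrealOfReal
      have hsum : ∀ {f : ℝ → ℝ}, MemLp f (ENNReal.ofReal p) (radialMeasure N) →
          ∫ x, g x * (μ + f x) ∂radialMeasure N
            = ∫ x, g x * μ ∂radialMeasure N + ∫ x, g x * f x ∂radialMeasure N := fun hf => by
        simp only [mul_add]
        exact integral_add ((hg.integrable hq1).mul_const μ) (hg.integrable_mul hf)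
      simp only [hsum hBp, hsum (hb _)]
      exact (tendsto_integral_mul_of_tendsto_setIntegral hpq hb hBp hlim
        (Eventually.of_forall hK) hg).const_add _)
    hv hv1
  have hw0 : NontrivialSol w := by
    obtain ⟨i, hi⟩ := (Metric.tendstoUniformlyOn_iff.1 hvw 1 one_pos).exists
    refine ⟨x i, hx i, fun h => ?_⟩
    have := hi (x i) (hx i)
    rw [h, Real.dist_eq, zero_sub, abs_neg, hvx i] at this
    exact lt_irrefl _ this
  refine ⟨B, hBm, hB0, hBp, fun hBz => ?_, hBC, w, ⟨w', hw⟩, hw0⟩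
  have hwμ : IsRadialNeumannSolutionDeriv N (fun _ => μ) w w' := by
    refine hw.congr_ae ?_
    filter_upwards [hBz] with x hx
    simp [hx]
  have hlim0 : Tendsto (fun i => ∫ x, b i x ∂radialMeasure N) U (nhds 0) := by
    simpa [integral_congr_ae hBz] using hlim univ MeasurableSet.univ
  obtain ⟨i, hi⟩ := (eventually_ae_eq_zero hbint hb0 hv hwμ hw0 (hwμ.ae_ne_zero hw0) hvw
    hlim0).exists
  exact hne i hi

theorem GammaSet.exists_perturbation {N : ℕ} {μ p : ℝ} (hp : 0 < p) {a : ℝ → ℝ}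
    (ha : GammaSet N μ a) (hap : RadialMemLp N p a) :
    ∃ b : ℝ → ℝ, (∀ x, 0 ≤ b x) ∧ MemLp b (ENNReal.ofReal p) (radialMeasure N) ∧
      ¬b =ᵐ[radialMeasure N] 0 ∧
      (∃ u, IsRadialNeumannSolution N (fun x => μ + b x) u ∧ NontrivialSol u) ∧
      radialLpNorm N p (fun r => a r - μ) = radialLpNorm N p b := by
  obtain ⟨ham, hprec, ⟨u, ⟨u', hu⟩, hu0⟩, -⟩ := ha
  rw [prec_iff (N := N)] at hprec
  have hab : ∀ᵐ x ∂radialMeasure N, a x - μ = max (a x - μ) 0 := by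
    filter_upwards [hprec.1] with x hx
    rw [max_eq_left (sub_nonneg.2 hx)]
  refine ⟨fun x => max (a x - μ) 0, fun x => le_max_right _ _, ?_, fun h => hprec.2 ?_,
    ⟨u, ⟨u', hu.congr_ae ?_⟩, hu0⟩, ?_⟩
  · exact (((radialMemLp_iff hp ham).1 hap).sub (memLp_const μ)).ae_eq hab
  · filter_upwards [h] with x hx
    have : max (a x - μ) 0 = 0 := hx
    linarith [le_max_left (a x - μ) 0]
  · filter_upwards [hab] with x hx
    rw [← hx, add_sub_cancel]
  · rw [radialLpNorm_eq, radialLpNorm_eq]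
    congr 2
    refine integral_congr_ae ?_
    filter_upwards [hab] with x hx
    rw [← hx]

theorem gammaSet_add {N : ℕ} (hN : 2 ≤ N) {μ p : ℝ} (hp : (N : ℝ) / 2 < p) {b : ℝ → ℝ}
    (hbm : Measurable b) (hb0 : ∀ x, 0 ≤ b x)
    (hb : MemLp b (ENNReal.ofReal p) (radialMeasure N)) (hne : ¬b =ᵐ[radialMeasure N] 0)
    (hu : ∃ u, IsRadialNeumannSolution N (fun x => μ + b x) u ∧ NontrivialSol u) :
    GammaSet N μ (fun x => μ + b x) ∧ RadialMemLp N p (fun x => μ + b x) := by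
  have hN' : (2 : ℝ) ≤ N := by exact_mod_cast hN
  have hm : Measurable fun x => μ + b x := hbm.const_add μ
  have hmem : MemLp (fun x => μ + b x) (ENNReal.ofReal p) (radialMeasure N) :=
    (memLp_const μ).add hb
  have hmem' : RadialMemLp N p (fun x => μ + b x) := (radialMemLp_iff (by linarith) hm).2 hmem
  refine ⟨⟨hm, (prec_iff (N := N)).2 ⟨Eventually.of_forall fun x => by linarith [hb0 x],
    fun h => hne ?_⟩, hu, ?_⟩, hmem'⟩
  · filter_upwards [h] with x hx
    exact le_antisymm (by simpa using hx) (hb0 x)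
  · split_ifs with h3
    · exact (radialMemLp_iff (by linarith) hm).2
        (hmem.mono_exponent (ENNReal.ofReal_le_ofReal hp.le))
    · exact Or.inl ⟨p, by linarith, hmem'⟩

/-- The supercritical case `N/2 < p < ∞`: `γ_{p,k} > 0` and the infimum is
attained at some `a₀ ∈ Γ_k ∩ L^p(B_1)`. -/
theorem stmt16 (N k : ℕ) (hN : 2 ≤ N) (p : ℝ) (hp : (N : ℝ) / 2 < p)
    (μk : ℝ) (φk : ℝ → ℝ) (rz : ℕ → ℝ)
    (hek : IsRadialNeumannEigenpair N k μk φk rz) :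
    0 < gammaLyap N μk p ∧
    ∃ a₀ : ℝ → ℝ, GammaSet N μk a₀ ∧ RadialMemLp N p a₀ ∧
      radialLpNorm N p (fun r => a₀ r - μk) = gammaLyap N μk p := by
  obtain ⟨hμ, hφ, hφ0, -⟩ := hek
  have hN' : (2 : ℝ) ≤ N := by exact_mod_cast hN
  have hp1 : 1 < p := by linarith
  have hp0 : 0 < p := by linarith
  have hpq := Real.HolderConjugate.conjExponent hp1
  have hω : 0 < omegaN N := omegaN_pos (by omega)
  have hI0 : ∀ b : ℝ → ℝ, 0 ≤ ∫ x, |b x| ^ p ∂radialMeasure N := fun b =>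
    integral_nonneg fun x => Real.rpow_nonneg (abs_nonneg _) _
  have hnorm0 : ∀ b : ℝ → ℝ, 0 ≤ radialLpNorm N p b := fun b => by
    rw [radialLpNorm_eq]
    exact Real.rpow_nonneg (mul_nonneg hω.le (hI0 b)) _
  set S : Set ℝ := {t : ℝ | ∃ a : ℝ → ℝ, GammaSet N μk a ∧ RadialMemLp N p a ∧
    t = radialLpNorm N p (fun r => a r - μk)} with hS
  have hγ : gammaLyap N μk p = sInf S := rfl
  have hSb : BddBelow S := ⟨0, by rintro _ ⟨a, -, -, rfl⟩; exact hnorm0 _⟩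
  have hSne : S.Nonempty := by
    obtain ⟨a, ha, hap⟩ := exists_gammaSet_radialMemLp hμ hφ hφ0
    exact ⟨_, a, ha, hap p hp0.le, rfl⟩
  have hγ0 : 0 ≤ sInf S := Real.sInf_nonneg (by rintro _ ⟨a, -, -, rfl⟩; exact hnorm0 _)
  obtain ⟨t, -, ht, htS⟩ := exists_seq_tendsto_sInf hSne hSb
  have hex : ∀ n, ∃ b : ℝ → ℝ, (∀ x, 0 ≤ b x) ∧
      MemLp b (ENNReal.ofReal p) (radialMeasure N) ∧ ¬b =ᵐ[radialMeasure N] 0 ∧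
      (∃ u, IsRadialNeumannSolution N (fun x => μk + b x) u ∧ NontrivialSol u) ∧
      t n = radialLpNorm N p b := by
    intro n
    obtain ⟨a, ha, hap, hta⟩ := htS n
    rw [hta]
    exact ha.exists_perturbation hp0 hap
  choose b hb0 hb hbne hbu htb using hex
  have hbint : ∀ n, ∫ x, |b n x| ^ p ∂radialMeasure N = t n ^ p / omegaN N := by
    intro n
    rw [htb n, radialLpNorm_eq, ← Real.rpow_mul (mul_nonneg hω.le (hI0 _)),
      one_div_mul_cancel hp0.ne', Real.rpow_one, mul_div_cancel_left₀ _ hω.ne']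
  have hlim : Tendsto (fun n => ∫ x, |b n x| ^ p ∂radialMeasure N) atTop
      (nhds (sInf S ^ p / omegaN N)) := by
    simp only [hbint]
    exact (ht.rpow_const (Or.inr hp0.le)).div_const _
  obtain ⟨K, hK⟩ := hlim.bddAbove_range
  obtain ⟨B, hBm, hB0, hB, hBne, hBC, hBu⟩ := exists_limit_perturbation (hyperfilter ℕ)
    (by omega) hpq hp hb0 hb (fun n => hK ⟨n, rfl⟩) (hlim.mono_left Nat.hyperfilter_le_atTop)
    hbne hbu
  obtain ⟨hΓ, hΓp⟩ := gammaSet_add hN hp hBm hB0 hB hBne hBu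
  have hsub : (fun r => μk + B r - μk) = B := by
    ext r; ring
  have heq : radialLpNorm N p (fun r => μk + B r - μk) = sInf S := by
    refine le_antisymm ?_ (csInf_le hSb ⟨_, hΓ, hΓp, rfl⟩)
    rw [hsub, radialLpNorm_eq, one_div, Real.rpow_inv_le_iff_of_pos
      (mul_nonneg hω.le (hI0 B)) hγ0 hp0, mul_comm]
    exact (le_div_iff₀ hω).1 hBC
  have hpos : 0 < radialLpNorm N p B := by
    rw [radialLpNorm_eq]
    refine Real.rpow_pos_of_pos (mul_pos hω ((hI0 B).lt_of_ne' fun h => hBne ?_)) _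
    have hBi : Integrable (fun x => |B x| ^ p) (radialMeasure N) := by
      have := hB.integrable_norm_rpow (by simpa using hp0) ENNReal.ofReal_ne_top
      simpa [ENNReal.toReal_ofReal hp0.le] using this
    rw [integral_eq_zero_iff_of_nonneg (fun x => Real.rpow_nonneg (abs_nonneg _) _) hBi] at h
    filter_upwards [h] with x hx
    simpa [Real.rpow_eq_zero (abs_nonneg (B x)) hp0.ne'] using hx
  rw [hγ]
  exact ⟨by rwa [← heq, hsub], _, hΓ, hΓp, heq⟩
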